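/- Let (t,w) be a semifinite zigzag growth model, and regard w as the finitary oriented paintbox whose i-th interval has length w_i and sign equal to the sign of the i-th infinite cluster of t; set φ_w(λ) = F_λ(w). Then for every zigzag λ, every μ ∈ Z(t) ∖ J(t), and every finitely supported family (c_ν)_ν of nonnegative reals indexed by zigzags such that the fundamental quasisymmetric functions satisfy F_λ · F_μ = ∑_ν c_ν F_ν, one has ∑_ν c_ν φ_{t,w}(ν) = φ_w(λ) · φ_{t,w}(μ), as an identity in [0,+∞]. -/

import Mathlib

/-!
Common definitions: the zigzag graph on binary words, templates and their coideals,
zigzag flanges and sections, the functions `F_λ(u)` and `φ_{t,w}`, and harmonic /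
semifinite / indecomposable functions on subgraphs of the zigzag graph.
-/

open scoped ENNReal NNReal

namespace Zigzag

/-- Binary words: `true` is `+`, `false` is `−`. -/
abbrev BW := List Bool

/-- `CoveredBy a b`: `b` covers `a` in the subword order, i.e. `|b| = |a| + 1` and `a`
is a subword of `b`; these are the edges of the zigzag graph. -/
def CoveredBy (a b : BW) : Prop := a.Sublist b ∧ b.length = a.length + 1

/-- The set of upper neighbours of `a` lying in `S` is finite. -/
lemma upSet_finite (S : Set BW) (a : BW) : {b | b ∈ S ∧ CoveredBy a b}.Finite :=
  (List.finite_length_eq Bool (a.length + 1)).subset (fun _ hb => hb.2.2)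

/-- The finset of upper neighbours of `a` inside `S`. -/
noncomputable def upFinset (S : Set BW) (a : BW) : Finset BW :=
  (upSet_finite S a).toFinset

/-- A `[0,∞]`-valued function is harmonic on `S ⊆ Z` (with the edges induced from the
zigzag graph) if its value at any vertex of `S` equals the sum of its values at the
upper neighbours lying in `S`. -/
def HarmonicOn (S : Set BW) (φ : BW → ℝ≥0∞) : Prop :=
  ∀ a ∈ S, φ a = ∑ b ∈ upFinset S a, φ b

/-- A template: a nonempty sequence of clusters with alternating signs, each cluster
being a sign (`true` = `+`, `false` = `−`) with a multiplicity in `{1,2,…} ∪ {∞}`,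
containing at least one infinite cluster. -/
structure Template where
  clusters : List (Bool × ℕ∞)
  ne : clusters ≠ []
  pos : ∀ c ∈ clusters, c.2 ≠ 0
  alternating : clusters.Chain' fun c d => c.1 ≠ d.1
  hasInf : ∃ c ∈ clusters, c.2 = ⊤

/-- The binary word obtained from a list of clusters by replacing every infinite
multiplicity by `N` (and keeping the finite multiplicities). -/
def clWord (cs : List (Bool × ℕ∞)) (N : ℕ) : BW :=
  (cs.map fun c => List.replicate (if c.2 = ⊤ then N else c.2.toNat) c.1).flatten

/-- The coideal generated by a list of clusters: all binary words that are subwords of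
some instantiation. -/
def Zcl (cs : List (Bool × ℕ∞)) : Set BW := {a | ∃ N, a.Sublist (clWord cs N)}

/-- The coideal `Z(t)` of the zigzag graph attached to a template `t`. -/
def Zt (t : Template) : Set BW := Zcl t.clusters

/-- The cluster in position `i` of `t` is a separating cluster: a one-symbol finite
cluster which is not outermost and whose two neighbours are infinite clusters
(necessarily of the same sign). -/
def Template.isSep (t : Template) (i : ℕ) : Prop :=
  0 < i ∧ i + 1 < t.clusters.length ∧
  (t.clusters.getD i (true, 1)).2 = 1 ∧
  (t.clusters.getD (i - 1) (true, 1)).2 = ⊤ ∧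
  (t.clusters.getD (i + 1) (true, 1)).2 = ⊤

/-- A template is finite if all its finite clusters are separating; otherwise it is
semifinite. -/
def Template.IsFiniteTemplate (t : Template) : Prop :=
  ∀ i < t.clusters.length, (t.clusters.getD i (true, 1)).2 ≠ ⊤ → t.isSep i

/-- The number of infinite clusters of a template. -/
def Template.numInf (t : Template) : ℕ :=
  (t.clusters.filter fun c => decide (c.2 = ⊤)).length

/-- Position `p` of `t` carries a finite non-separating cluster, i.e. a cluster
contributing to the zigzag flange of `t`. -/
def IsFlangePos (t : Template) (p : ℕ) : Prop :=
  p < t.clusters.length ∧ (t.clusters.getD p (true, 1)).2 ≠ ⊤ ∧ ¬t.isSep p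

/-- Decrease by one the multiplicity of the cluster in position `p`. -/
def decAt (cs : List (Bool × ℕ∞)) (p : ℕ) : List (Bool × ℕ∞) :=
  cs.set p ((cs.getD p (true, 1)).1, (cs.getD p (true, 1)).2 - 1)

/-- The coideal `J(t)`: the union of the coideals `Z(r)` over all `r` obtained from `t`
by removing a single symbol from a cluster corresponding to a block of a binary word
from the zigzag flange of `t` (no merging of clusters is needed to generate `Z(r)`). -/
def Jt (t : Template) : Set BW :=
  {a | ∃ p, IsFlangePos t p ∧ a ∈ Zcl (decAt t.clusters p)}

/-- The canonical splitting of a template `t` into its zigzag flange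
`fl(t) = (a₀, …, a_k)` (given by the lists `A 0, …, A k` of clusters, each consisting
of finite non-separating clusters of `t`) and its sections `t₁, …, t_k` (the maximal
groups of consecutive clusters forming finite templates), so that
`t = (a₀, t₁, a₁, …, a_{k−1}, t_k, a_k)`.  The two `interior` conditions express the
maximality of the decomposition. -/
structure SectionData (t : Template) where
  k : ℕ
  A : Fin (k + 1) → List (Bool × ℕ∞)
  T : Fin k → Template
  concat : t.clusters
      = A 0 ++ (List.ofFn fun i : Fin k => (T i).clusters ++ A i.succ).flatten
  finA : ∀ j, ∀ c ∈ A j, c.2 ≠ ⊤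
  secFin : ∀ i, (T i).IsFiniteTemplate
  interior_ne : ∀ j : Fin (k + 1), (j : ℕ) ≠ 0 → (j : ℕ) ≠ k → A j ≠ []
  interior_not_sep : ∀ j : Fin (k + 1), (j : ℕ) ≠ 0 → (j : ℕ) ≠ k →
      ∀ s : Bool, A j ≠ [(s, 1)]

/-- The binary word corresponding to a list of finite clusters (a flange word). -/
def flangeWord (cs : List (Bool × ℕ∞)) : BW :=
  (cs.map fun c => List.replicate c.2.toNat c.1).flatten

/-- `a₀ ⊔ ℓ 1 ⊔ a₁ ⊔ … ⊔ ℓ k ⊔ a_k` (empty flange words disappear). -/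
def assemble {t : Template} (D : SectionData t) (ℓ : Fin D.k → BW) : BW :=
  flangeWord (D.A 0) ++ (List.ofFn fun i : Fin D.k => ℓ i ++ flangeWord (D.A i.succ)).flatten

/-- `ℓ` is a decomposition of `a` along the sections of `t`:
`bw(a) = a₀ ⊔ bw(ℓ 1) ⊔ a₁ ⊔ … ⊔ bw(ℓ k) ⊔ a_k` with `ℓ i ∈ Z(tᵢ)`. -/
def decompOf {t : Template} (D : SectionData t) (a : BW) (ℓ : Fin D.k → BW) : Prop :=
  (∀ i, ℓ i ∈ Zt (D.T i)) ∧ a = assemble D ℓ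

/-- The signs of the infinite clusters of a list of clusters, in order. -/
def infSigns (cs : List (Bool × ℕ∞)) : List Bool :=
  (cs.filter fun c => decide (c.2 = ⊤)).map Prod.fst

/-- The number of weights consumed by the sections preceding the `i`-th one. -/
def secOffset {t : Template} (D : SectionData t) (i : Fin D.k) : ℕ :=
  ∑ i' ∈ Finset.univ.filter (· < i), (infSigns (D.T i').clusters).length

/-- The part `vᵢ` of the tuple of weights `w` corresponding to the infinite clusters of
the `i`-th section, as a sequence of (sign, weight) pairs. -/
def vD {t : Template} (D : SectionData t) (w : List ℝ) (i : Fin D.k) : List (Bool × ℝ) :=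
  (infSigns (D.T i).clusters).zip (w.drop (secOffset D i))

/-- `F_λ(u)` for a finite sequence `u` of (sign, length) pairs and a zigzag `λ`
(encoded by its binary word `a`, so that `λ` has `a.length + 1` boxes): the sum, over
all decompositions of `λ` into `u.length` consecutive (possibly empty) zigzags
`λ(1), …, λ(m)` with `λ(i)` a row when the `i`-th sign is `+` and a column when it is
`−`, of `u₁ ^ |λ(1)| ⋯ u_m ^ |λ(m)|`.  A decomposition is recorded by the tuple `c` of
the numbers of boxes of the pieces; the row/column constraint says that the letters of
`a` strictly inside the `i`-th group of boxes all equal the `i`-th sign. -/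
noncomputable def Fword (u : List (Bool × ℝ)) (a : BW) : ℝ :=
  ∑ c ∈ (Finset.Nat.antidiagonalTuple u.length (a.length + 1)).filter
      (fun c => ∀ i : Fin u.length,
        (a.drop (∑ i' ∈ Finset.univ.filter (· < i), c i')).take (c i - 1)
          = List.replicate (c i - 1) (u.get i).1),
    ∏ i, (u.get i).2 ^ c i

open Classical in
/-- The function `φ_{t,w}` attached to a semifinite zigzag growth model `(t, w)`:
it equals `+∞` on `J(t)`, and on `Z(t) ∖ J(t)` it equals
`F_{λ^{(1)}}(v₁) ⋯ F_{λ^{(k)}}(v_k)`, where `(λ^{(1)}, …, λ^{(k)})` is the (unique)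
decomposition of `λ` along the sections of `t` (it is `0` off `Z(t)`). -/
noncomputable def phiTW (t : Template) (D : SectionData t) (w : List ℝ) (a : BW) : ℝ≥0∞ :=
  if a ∉ Zt t then 0
  else if a ∈ Jt t then ⊤
  else if h : ∃ ℓ : Fin D.k → BW, decompOf D a ℓ then
    ENNReal.ofReal (∏ i, Fword (vD D w i) (h.choose i))
  else 0

section Kcone

/-- The relation `λ = ∑_{μ : λ ↗ μ} μ` (within `S`) as an element of the free module. -/
noncomputable def relOf (S : Set BW) (a : BW) : BW →₀ ℝ :=
  Finsupp.single a 1 - ∑ b ∈ upFinset S a, Finsupp.single b 1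

/-- The submodule of relations defining `K(S)`. -/
noncomputable def Krel (S : Set BW) : Submodule ℝ (BW →₀ ℝ) :=
  Submodule.span ℝ {f | ∃ a ∈ S, f = relOf S a}

/-- The class of `f` in `K(S) = (⊕_{λ ∈ S} ℝ λ) ⧸ (relations)`. -/
noncomputable def kmk (S : Set BW) (f : BW →₀ ℝ) : (BW →₀ ℝ) ⧸ Krel S :=
  Submodule.Quotient.mk f

/-- Nonnegative formal combinations of vertices of `S`. -/
def NonnegOn (S : Set BW) (f : BW →₀ ℝ) : Prop :=
  (∀ x, 0 ≤ f x) ∧ ∀ x ∈ f.support, x ∈ S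

/-- The cone `K⁺(S)` spanned by the vertices of `S` in `K(S)`. -/
noncomputable def Kpos (S : Set BW) : Set ((BW →₀ ℝ) ⧸ Krel S) :=
  kmk S '' {f | NonnegOn S f}

/-- The order defined by the cone `K⁺(S)`: `x ≤_K y` iff `y − x ∈ K⁺(S)`. -/
def leK (S : Set BW) (x y : (BW →₀ ℝ) ⧸ Krel S) : Prop := y - x ∈ Kpos S

/-- The value of (the canonical extension of) `φ` at a nonnegative combination of
vertices. -/
noncomputable def phiHat (φ : BW → ℝ≥0∞) (f : BW →₀ ℝ) : ℝ≥0∞ :=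
  ∑ x ∈ f.support, ENNReal.ofReal (f x) * φ x

/-- `φ` is finite on `S`. -/
def FiniteOn (S : Set BW) (φ : BW → ℝ≥0∞) : Prop := ∀ a ∈ S, φ a ≠ ⊤

/-- `φ` is a semifinite function on (the graph) `S`: it is not everywhere finite, and
its value at any element `a` of the cone `K⁺` is the supremum of its values at the
elements `b ≤_K a` of the cone where it is finite. -/
def SemifiniteOn (S : Set BW) (φ : BW → ℝ≥0∞) : Prop :=
  (∃ a ∈ S, φ a = ⊤) ∧
  ∀ f : BW →₀ ℝ, NonnegOn S f →
    phiHat φ f =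
      ⨆ g ∈ {g : BW →₀ ℝ |
        NonnegOn S g ∧ leK S (kmk S g) (kmk S f) ∧ phiHat φ g ≠ ⊤}, phiHat φ g

/-- A semifinite harmonic function `φ` on `S` is indecomposable if any finite or
semifinite harmonic function `φ′ ≤ φ` on `S` which does not vanish identically on the
finiteness ideal of `φ` is a constant multiple of `φ` on that ideal. -/
def IndecSemifiniteOn (S : Set BW) (φ : BW → ℝ≥0∞) : Prop :=
  ∀ φ' : BW → ℝ≥0∞, HarmonicOn S φ' →
    (FiniteOn S φ' ∨ SemifiniteOn S φ') →
    (∀ a ∈ S, φ' a ≤ φ a) →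
    (∃ a ∈ S, φ a ≠ ⊤ ∧ φ' a ≠ 0) →
    ∃ c : ℝ≥0, ∀ a ∈ S, φ a ≠ ⊤ → φ' a = (c : ℝ≥0∞) * φ a

end Kcone

end Zigzag

namespace Zigzag

/-- The fundamental quasisymmetric function of a zigzag (given by its binary word `a`,
with `n = a.length + 1` boxes): `F_λ = ∑ x_{i₁} ⋯ x_{i_n}` over all weakly increasing
sequences `i₁ ≤ … ≤ i_n` that are strict at the descents of `λ` (the `−` letters of
`a`); the coefficient of a monomial `d` is the number of such sequences with exponent
record `d`. -/
noncomputable def Fqs (a : BW) : MvPowerSeries ℕ ℝ :=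
  fun d => (Nat.card {i : Fin (a.length + 1) → ℕ //
    (∀ j : Fin a.length, i j.castSucc ≤ i j.succ) ∧
    (∀ j : Fin a.length, a.get j = false → i j.castSucc < i j.succ) ∧
    (∑ j, Finsupp.single (i j) 1) = d} : ℝ)

/-- The finitary oriented paintbox attached to a semifinite zigzag growth model
`(t, w)`: the `i`-th interval has length `w_i` and the sign of the `i`-th infinite
cluster of `t`. -/
def paintboxOf (t : Template) (w : List ℝ) : List (Bool × ℝ) :=
  (infSigns t.clusters).zip w

/-! ### Convolution of functionals on box lists

A zigzag with `n` boxes is encoded by a list of length `n` whose head is irrelevant and whose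
tail is the binary word; consecutive decompositions of the zigzag are then splittings of the
list. -/

section Convolution

variable {R : Type*} [CommSemiring R]

/-- Convolution: the sum of `f P * g Q` over all splittings of a list as `P ++ Q`. -/
def conv (f g : List Bool → R) : List Bool → R
  | [] => f [] * g []
  | x :: l => f [] * g (x :: l) + conv (fun p => f (x :: p)) g l

/-- The unit for convolution. -/
def cunit : List Bool → R
  | [] => 1
  | _ :: _ => 0

/-- A functional that does not depend on the head of the list. -/
def HeadFree (f : List Bool → R) : Prop := ∀ x y l, f (x :: l) = f (y :: l)

lemma conv_eq_sum (f g : List Bool → R) (l : List Bool) :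
    conv f g l = ∑ i ∈ Finset.range (l.length + 1), f (l.take i) * g (l.drop i) := by
  induction l generalizing f with
  | nil => simp [conv]
  | cons x l ih =>
    rw [conv, ih, List.length_cons, Finset.sum_range_succ' _ (l.length + 1)]
    simpa using add_comm _ _

lemma conv_add_left (f f' g : List Bool → R) (l : List Bool) :
    conv (fun p => f p + f' p) g l = conv f g l + conv f' g l := by
  simp [conv_eq_sum, add_mul, Finset.sum_add_distrib]

lemma conv_mul_left (a : R) (f g : List Bool → R) (l : List Bool) :
    conv (fun p => a * f p) g l = a * conv f g l := by
  simp [conv_eq_sum, Finset.mul_sum, mul_assoc]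

lemma conv_assoc (f g h : List Bool → R) (l : List Bool) :
    conv (conv f g) h l = conv f (conv g h) l := by
  induction l generalizing f with
  | nil => simp [conv, mul_assoc]
  | cons x l ih =>
    simp only [conv]
    rw [conv_add_left, conv_mul_left, ih]
    ring

lemma conv_cunit_left (g : List Bool → R) (l : List Bool) : conv cunit g l = g l := by
  rw [conv_eq_sum, Finset.sum_eq_single 0]
  · simp [cunit]
  · intro i hi h0
    cases l with
    | nil => simp at hi; omega
    | cons x l =>
      cases i with
      | zero => simp at h0
      | succ i => simp [cunit]
  · simp

lemma HeadFree.conv {f g : List Bool → R} (hf : HeadFree f) (hg : HeadFree g) :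
    HeadFree (conv f g) := by
  intro x y l
  simp only [Zigzag.conv]
  rw [hg x y l, show (fun p => f (x :: p)) = fun p => f (y :: p) from funext fun p => hf x y p]

lemma HeadFree.cunit : HeadFree (cunit : List Bool → R) := fun _ _ _ => rfl

lemma exists_of_conv_ne_zero {f g : List Bool → R} {l : List Bool} (h : conv f g l ≠ 0) :
    ∃ p q, l = p ++ q ∧ f p ≠ 0 ∧ g q ≠ 0 := by
  rw [conv_eq_sum] at h
  obtain ⟨i, _, hi⟩ := Finset.exists_ne_zero_of_sum_ne_zero h
  exact ⟨_, _, (List.take_append_drop i l).symm, left_ne_zero_of_mul hi, right_ne_zero_of_mul hi⟩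

lemma conv_eq_single {f g : List Bool → R} {p q : List Bool}
    (h : ∀ p' q', p ++ q = p' ++ q' → f p' ≠ 0 → g q' ≠ 0 → p'.length = p.length) :
    conv f g (p ++ q) = f p * g q := by
  rw [conv_eq_sum, Finset.sum_eq_single p.length]
  · simp
  · intro i hi hne
    by_contra h0
    have := h _ _ (List.take_append_drop i (p ++ q)).symm (left_ne_zero_of_mul h0)
      (right_ne_zero_of_mul h0)
    simp at this hi
    omega
  · simp

/-- The words of the shuffles of two zigzags.  The flag records whether the previous box comes
from the first zigzag; a step from the first to the second zigzag is an ascent, and a step from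
the second to the first one is a descent. -/
def shuf : Bool → List Bool → List Bool → List (List Bool)
  | _, [], [] => [[]]
  | q, x :: l, [] => (shuf true l []).map (List.cons (q && x))
  | q, [], y :: m => (shuf false [] m).map (List.cons (q || y))
  | q, x :: l, y :: m =>
    (shuf true l (y :: m)).map (List.cons (q && x)) ++
      (shuf false (x :: l) m).map (List.cons (q || y))

/-- The sum of a functional over the shuffles of two zigzags. -/
def shufSum {A : Type*} [AddCommMonoid A] (q : Bool) (f : List Bool → A) (l m : List Bool) : A :=
  ((shuf q l m).map f).sum

section
variable {A : Type*} [AddCommMonoid A] (q : Bool) (f : List Bool → A) (x y : Bool)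
  (l m : List Bool)

@[simp] lemma shufSum_nil_nil : shufSum q f [] [] = f [] := by simp [shufSum, shuf]

@[simp] lemma shufSum_cons_nil :
    shufSum q f (x :: l) [] = shufSum true (fun n => f ((q && x) :: n)) l [] := by
  simp [shufSum, shuf, Function.comp_def]

@[simp] lemma shufSum_nil_cons :
    shufSum q f [] (y :: m) = shufSum false (fun n => f ((q || y) :: n)) [] m := by
  simp [shufSum, shuf, Function.comp_def]

@[simp] lemma shufSum_cons_cons :
    shufSum q f (x :: l) (y :: m) =
      shufSum true (fun n => f ((q && x) :: n)) l (y :: m) +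
        shufSum false (fun n => f ((q || y) :: n)) (x :: l) m := by
  simp [shufSum, shuf, Function.comp_def]
end

lemma shufSum_add (q : Bool) (f g : List Bool → R) (l m : List Bool) :
    shufSum q (fun n => f n + g n) l m = shufSum q f l m + shufSum q g l m := by
  simp [shufSum]

lemma shufSum_mul_left (q : Bool) (a : R) (f : List Bool → R) (l m : List Bool) :
    shufSum q (fun n => a * f n) l m = a * shufSum q f l m := by
  simp [shufSum, List.sum_map_mul_left]

lemma HeadFree.shufSum_eq {f : List Bool → R} (hf : HeadFree f) (q q' : Bool)
    (l m : List Bool) : shufSum q f l m = shufSum q' f l m := by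
  have h : ∀ a b : Bool, (fun n => f (a :: n)) = fun n => f (b :: n) :=
    fun a b => funext fun n => hf a b n
  cases l <;> cases m <;> simp only [shufSum_nil_nil, shufSum_cons_nil, shufSum_nil_cons,
    shufSum_cons_cons]
  · rw [h (q || _) (q' || _)]
  · rw [h (q && _) (q' && _)]
  · rw [h (q || _) (q' || _), h (q && _) (q' && _)]

/-- Shuffles are compatible with splittings: the coproduct is multiplicative. -/
lemma shufSum_conv (q : Bool) (f : List Bool → R) {g : List Bool → R} (hg : HeadFree g)
    (l m : List Bool) :
    shufSum q (conv f g) l m =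
      ∑ i ∈ Finset.range (l.length + 1), ∑ j ∈ Finset.range (m.length + 1),
        shufSum q f (l.take i) (m.take j) * shufSum false g (l.drop i) (m.drop j) := by
  induction l generalizing q f m with
  | nil =>
    induction m generalizing q f with
    | nil => simp [conv]
    | cons y m ih =>
      simp only [shufSum_nil_cons, conv]
      rw [shufSum_add, shufSum_mul_left, ih]
      simp only [List.length_nil, zero_add, Finset.range_one, Finset.sum_singleton,
        List.take_nil, List.drop_nil, List.length_cons]
      rw [Finset.sum_range_succ' _ (m.length + 1)]
      simp only [List.take_succ_cons, List.drop_succ_cons, List.take_zero, List.drop_zero,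
        shufSum_nil_cons, shufSum_nil_nil]
      rw [← shufSum_nil_cons q g, hg.shufSum_eq q false, shufSum_nil_cons]
      ring
  | cons x l ihl =>
    induction m generalizing q f with
    | nil =>
      simp only [shufSum_cons_nil, conv]
      rw [shufSum_add, shufSum_mul_left, ihl]
      simp only [List.length_nil, zero_add, Finset.range_one, Finset.sum_singleton,
        List.take_nil, List.drop_nil, List.length_cons]
      rw [Finset.sum_range_succ' _ (l.length + 1)]
      simp only [List.take_succ_cons, List.drop_succ_cons, List.take_zero, List.drop_zero,
        shufSum_cons_nil, shufSum_nil_nil]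
      rw [← shufSum_cons_nil q g, hg.shufSum_eq q false, shufSum_cons_nil]
      ring
    | cons y m ihm =>
      simp only [shufSum_cons_cons, conv]
      rw [shufSum_add, shufSum_add, shufSum_mul_left, shufSum_mul_left, ihl, ihm]
      have h0 := shufSum_cons_cons q g x y l m
      rw [hg.shufSum_eq q false] at h0
      simp only [List.length_cons]
      simp only [Finset.sum_range_succ' _ (l.length + 1), Finset.sum_range_succ' _ (m.length + 1)]
      simp only [List.take_succ_cons, List.drop_succ_cons, List.take_zero, List.drop_zero,
        shufSum_cons_cons, shufSum_cons_nil, shufSum_nil_cons, shufSum_nil_nil,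
        add_mul, Finset.sum_add_distrib]
      rw [← shufSum_cons_cons false g, h0]
      ring

/-- A criterion for multiplicativity of a convolution. -/
lemma shufSum_conv_eq_mul {q : Bool} {f g wf wg : List Bool → R} (hg : HeadFree g)
    {l m : List Bool}
    (h : ∀ l₁ l₂ m₁ m₂, l = l₁ ++ l₂ → m = m₁ ++ m₂ →
      shufSum q f l₁ m₁ * shufSum false g l₂ m₂ = (wf l₁ * f m₁) * (wg l₂ * g m₂)) :
    shufSum q (conv f g) l m = conv wf wg l * conv f g m := by
  rw [shufSum_conv q f hg, conv_eq_sum, conv_eq_sum, Finset.sum_mul_sum]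
  refine Finset.sum_congr rfl fun i _ => Finset.sum_congr rfl fun j _ => ?_
  rw [h _ _ _ _ (List.take_append_drop i l).symm (List.take_append_drop j m).symm]
  ring

/-- The functional of a single interval of sign `s` and length `x`. -/
def interval (s : Bool) (x : R) (l : List Bool) : R :=
  if ∀ b ∈ l.tail, b = s then x ^ l.length else 0

lemma HeadFree.interval (s : Bool) (x : R) : HeadFree (interval s x) := fun _ _ _ => rfl

/-- The variant of `interval` that also constrains the head. -/
def intervalAll (s : Bool) (x : R) (l : List Bool) : R :=
  if ∀ b ∈ l, b = s then x ^ l.length else 0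

lemma interval_cons (s : Bool) (x : R) (b : Bool) (l : List Bool) :
    interval s x (b :: l) = x * intervalAll s x l := by
  simp only [interval, intervalAll, List.tail_cons, List.length_cons, mul_ite, mul_zero, pow_succ']

lemma intervalAll_cons (s : Bool) (x : R) (b : Bool) (l : List Bool) :
    intervalAll s x (b :: l) = if b = s then x * intervalAll s x l else 0 := by
  by_cases hb : b = s <;>
    simp [intervalAll, List.mem_cons, forall_eq_or_imp, List.length_cons, hb, pow_succ']

@[simp] lemma interval_nil (s : Bool) (x : R) : interval s x [] = 1 := by simp [interval]

@[simp] lemma intervalAll_nil (s : Bool) (x : R) : intervalAll s x [] = 1 := by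
  simp [intervalAll]

@[simp] lemma shufSum_zero (q : Bool) (l m : List Bool) :
    shufSum q (fun _ => (0 : R)) l m = 0 := by
  simp [shufSum]

lemma shufSum_ite (q : Bool) (p : Prop) [Decidable p] (a : R) (f : List Bool → R)
    (l m : List Bool) :
    shufSum q (fun n => if p then a * f n else 0) l m
      = if p then a * shufSum q f l m else 0 := by
  split_ifs
  · exact shufSum_mul_left ..
  · simp [shufSum]

lemma shufSum_intervalAll_true (x : R) (q : Bool) (l m : List Bool) :
    shufSum q (intervalAll true x) l m =
      if q then intervalAll true x l * interval true x m
      else cunit l * intervalAll true x m := by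
  induction l generalizing q m with
  | nil =>
    induction m generalizing q with
    | nil => simp [cunit]
    | cons y m ih =>
      cases q <;> simp [intervalAll_cons, interval_cons, shufSum_ite, shufSum_mul_left, ih, cunit]
  | cons b l ihl =>
    induction m generalizing q with
    | nil =>
      cases q <;> simp [intervalAll_cons, shufSum_ite, ihl, cunit]
    | cons y m ihm =>
      cases q <;> simp [intervalAll_cons, interval_cons, shufSum_ite, shufSum_mul_left, ihl, ihm,
        cunit, mul_assoc, mul_left_comm]

lemma shufSum_intervalAll_false (x : R) (q : Bool) (l m : List Bool) :
    shufSum q (intervalAll false x) l m =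
      if q then intervalAll false x l * cunit m
      else interval false x l * intervalAll false x m := by
  induction l generalizing q m with
  | nil =>
    induction m generalizing q with
    | nil => simp [cunit]
    | cons y m ih =>
      cases q <;> simp [intervalAll_cons, shufSum_ite, ih, cunit]
  | cons b l ihl =>
    induction m generalizing q with
    | nil =>
      cases q <;> simp [intervalAll_cons, interval_cons, shufSum_ite, shufSum_mul_left, ihl,
        cunit]
    | cons y m ihm =>
      cases q <;> simp [intervalAll_cons, interval_cons, shufSum_ite, shufSum_mul_left, ihl, ihm,
        cunit, mul_assoc, mul_left_comm]

lemma shufSum_interval (s : Bool) (x : R) (q : Bool) (l m : List Bool) :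
    shufSum q (interval s x) l m = interval s x l * interval s x m := by
  cases l <;> cases m <;> cases s <;>
    simp [interval_cons, shufSum_mul_left, shufSum_intervalAll_true, shufSum_intervalAll_false,
      cunit] <;> ring

/-- The functional `λ ↦ F_λ(u)` on box lists. -/
def evalF (u : List (Bool × R)) : List Bool → R :=
  u.foldr (fun c f => conv (interval c.1 c.2) f) cunit

@[simp] lemma evalF_nil : evalF ([] : List (Bool × R)) = cunit := rfl

@[simp] lemma evalF_cons (c : Bool × R) (u : List (Bool × R)) :
    evalF (c :: u) = conv (interval c.1 c.2) (evalF u) := rfl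

lemma HeadFree.evalF (u : List (Bool × R)) : HeadFree (evalF u) := by
  induction u with
  | nil => exact HeadFree.cunit
  | cons c u ih => exact (HeadFree.interval _ _).conv ih

lemma evalF_append (u v : List (Bool × R)) (l : List Bool) :
    evalF (u ++ v) l = conv (evalF u) (evalF v) l := by
  induction u generalizing l with
  | nil => simp [conv_cunit_left]
  | cons c u ih =>
    simp only [List.cons_append, evalF_cons]
    rw [conv_assoc, show evalF (u ++ v) = conv (evalF u) (evalF v) from funext ih]

lemma shufSum_cunit (q : Bool) (l m : List Bool) :
    shufSum q cunit l m = (cunit l * cunit m : R) := by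
  cases l <;> cases m <;> simp [cunit]

/-- `F_λ(u)` is multiplicative: it is a character of the algebra of quasisymmetric functions. -/
lemma shufSum_evalF (u : List (Bool × R)) (q : Bool) (l m : List Bool) :
    shufSum q (evalF u) l m = evalF u l * evalF u m := by
  induction u generalizing q l m with
  | nil => simp [shufSum_cunit]
  | cons c u ih =>
    simp only [evalF_cons]
    exact shufSum_conv_eq_mul (HeadFree.evalF u) fun _ _ _ _ _ _ => by
      rw [shufSum_interval, ih]

lemma length_of_mem_shuf {q : Bool} {l m n : List Bool} (h : n ∈ shuf q l m) :
    n.length = l.length + m.length := by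
  induction l generalizing q m n with
  | nil =>
    induction m generalizing q n with
    | nil => simp [shuf] at h; simp [h]
    | cons y m ih =>
      simp only [shuf, List.mem_map] at h
      obtain ⟨n, hn, rfl⟩ := h
      have := ih hn
      simp at this ⊢; omega
  | cons b l ihl =>
    induction m generalizing q n with
    | nil =>
      simp only [shuf, List.mem_map] at h
      obtain ⟨n, hn, rfl⟩ := h
      have := ihl hn
      simp at this ⊢; omega
    | cons y m ihm =>
      simp only [shuf, List.mem_append, List.mem_map] at h
      obtain ⟨n, hn, rfl⟩ | ⟨n, hn, rfl⟩ := h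
      · have := ihl hn
        simp at this ⊢; omega
      · have := ihm hn
        simp at this ⊢; omega

lemma sublist_of_mem_shuf {q : Bool} {l m n : List Bool} (h : n ∈ shuf q l m) :
    m.Sublist (if q then false :: n else n) := by
  induction l generalizing q m n with
  | nil =>
    induction m generalizing q n with
    | nil => simp
    | cons y m ih =>
      simp only [shuf, List.mem_map] at h
      obtain ⟨n, hn, rfl⟩ := h
      have := ih hn
      cases q <;> cases y <;> simp at this ⊢ <;> grind
  | cons b l ihl =>
    induction m generalizing q n with
    | nil => simp
    | cons y m ihm =>
      simp only [shuf, List.mem_append, List.mem_map] at h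
      obtain ⟨n, hn, rfl⟩ | ⟨n, hn, rfl⟩ := h
      · have := ihl hn
        cases q <;> simp at this ⊢
        · exact this
        · exact this.trans (by grind)
      · have := ihm hn
        cases q <;> cases y <;> simp at this ⊢ <;> grind

lemma shuf_nil_left (m : List Bool) : shuf false [] m = [m] := by
  induction m with
  | nil => simp [shuf]
  | cons y m ih => simp [shuf, ih]

end Convolution

/-! ### Sections and flange words, abstractly -/

/-- The data attached to a section of a template: its functional `f` on box lists, its coideal
`Z`, and the signs `p`, `q` of its first and last clusters. -/
structure Sec where
  f : List Bool → ℝ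
  Z : Set BW
  p : Bool
  q : Bool
  headFree : HeadFree f
  mul : ∀ l m, shufSum false f l m = f l * f m
  mem : ∀ l, f l ≠ 0 → l.tail ∈ Z
  down : ∀ {a b : BW}, a.Sublist b → b ∈ Z → a ∈ Z
  nil : [] ∈ Z
  cons : ∀ {a}, a ∈ Z → p :: a ∈ Z
  snoc : ∀ {a}, a ∈ Z → a ++ [q] ∈ Z

/-- The functional dual to the zigzag with box list `b`. -/
noncomputable def delta (b l : List Bool) : ℝ :=
  if l.length = b.length ∧ l.tail = b.tail then 1 else 0

/-- The box lists of the zigzags contained in the one with box list `b`. -/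
def SubBox (b l : List Bool) : Prop := l.length ≤ b.length ∧ l.tail.Sublist b.tail

/-- The boxes of the flange word `b` when it is followed by the sections `r`: its last symbol
plays the role of the head of the next section. -/
def core (b : BW) : List (Sec × BW) → BW
  | [] => b
  | _ :: _ => b.dropLast

/-- The symbol of the flange word `b` not taken into account by `core`. -/
def link (b : BW) : List (Sec × BW) → BW
  | [] => []
  | _ :: _ => b.getLast?.toList

lemma core_append_link (b : BW) (r : List (Sec × BW)) : core b r ++ link b r = b := by
  cases r with
  | nil => simp [core, link]
  | cons i r =>
    rcases List.eq_nil_or_concat b with rfl | ⟨b, c, rfl⟩ <;> simp [core, link]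

/-- The finite functional which agrees with `φ_{t,w}` away from `J(t)`. -/
noncomputable def psi : List (Sec × BW) → List Bool → ℝ
  | [] => cunit
  | (s, b) :: r => conv s.f (conv (delta (core b r)) (psi r))

/-- The convolution of the functionals of all sections. -/
noncomputable def psiFree : List (Sec × BW) → List Bool → ℝ
  | [] => cunit
  | (s, _) :: r => conv s.f (psiFree r)

/-- The compatibility of the signs of sections and flange words. -/
def Compatible : List (Sec × BW) → Prop
  | [] => True
  | (s, b) :: r => (∀ x ∈ b.head?, x = !s.q) ∧
      (∀ i ∈ r.head?, b ≠ [] ∧ ∀ c ∈ b.getLast?, i.1.p = !c) ∧ Compatible r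

/-- Splittings of a box list along sections and flange words; if the flag is raised then some
flange word is not used completely. -/
def BoxDec : Bool → List (Sec × BW) → List Bool → Prop
  | j, [], l => l = [] ∧ j = false
  | j, (s, b) :: r, l => ∃ P P' Q j', l = P ++ (P' ++ Q) ∧ P.tail ∈ s.Z ∧
      SubBox (core b r) P' ∧ BoxDec j' r Q ∧
      (j = true → P'.length < (core b r).length ∨ j' = true)

/-- Splittings of a binary word along sections and flange words; if the flag is raised then some
flange word is not used completely. -/
def WordDec : Bool → List (Sec × BW) → BW → Prop
  | j, [], a => a = [] ∧ j = false
  | j, (s, b) :: r, a => ∃ l b' a' j', a = l ++ (b' ++ a') ∧ l ∈ s.Z ∧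
      b'.Sublist b ∧ WordDec j' r a' ∧ (j = true → b' ≠ b ∨ j' = true)

lemma WordDec.weaken {j : Bool} {r : List (Sec × BW)} {a : BW} (h : WordDec true r a) :
    WordDec j r a := by
  cases r with
  | nil => simp [WordDec] at h
  | cons i r =>
    obtain ⟨l, b', a', j', h1, h2, h3, h4, h5⟩ := h
    exact ⟨l, b', a', j', h1, h2, h3, h4, fun _ => h5 rfl⟩

lemma WordDec.toFalse {j : Bool} {r : List (Sec × BW)} {a : BW} (h : WordDec j r a) :
    WordDec false r a := by
  cases j with
  | false => exact h
  | true => exact h.weaken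

lemma BoxDec.toFalse {j : Bool} {r : List (Sec × BW)} {a : BW} (h : BoxDec j r a) :
    BoxDec false r a := by
  cases r with
  | nil => exact ⟨h.1, rfl⟩
  | cons i r =>
    obtain ⟨l, b', a', j', h1, h2, h3, h4, h5⟩ := h
    exact ⟨l, b', a', j', h1, h2, h3, h4, by simp⟩

lemma WordDec.sublist {r : List (Sec × BW)} {a a' : BW} (h : WordDec false r a)
    (ha : a'.Sublist a) : WordDec false r a' := by
  induction r generalizing a a' with
  | nil =>
    obtain ⟨rfl, -⟩ := h
    exact ⟨by simpa using ha, rfl⟩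
  | cons i r ih =>
    obtain ⟨l, b', a'', j', rfl, h2, h3, h4, -⟩ := h
    obtain ⟨l1, l2, rfl, hl1, hl2⟩ := List.sublist_append_iff.1 ha
    obtain ⟨l3, l4, rfl, hl3, hl4⟩ := List.sublist_append_iff.1 hl2
    exact ⟨l1, l3, l4, false, rfl, i.1.down hl1 h2, hl3.trans h3, ih h4.toFalse hl4, by simp⟩

lemma WordDec.cons {j : Bool} {i : Sec × BW} {r : List (Sec × BW)} {a : BW}
    (h : WordDec j (i :: r) a) : WordDec j (i :: r) (i.1.p :: a) := by
  obtain ⟨l, b', a', j', rfl, h2, h3, h4, h5⟩ := h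
  exact ⟨i.1.p :: l, b', a', j', rfl, i.1.cons h2, h3, h4, h5⟩

lemma WordDec.nil (r : List (Sec × BW)) : WordDec false r [] := by
  induction r with
  | nil => simp [WordDec]
  | cons i r ih => exact ⟨[], [], [], false, rfl, i.1.nil, by simp, ih, by simp⟩

/-- The boxes following a flange word: the head of the next section either completes the flange
word or is absorbed by the section. -/
lemma link_or {b : BW} {r : List (Sec × BW)} (hb : ∀ i ∈ r.head?, b ≠ [] ∧ ∀ c ∈ b.getLast?,
      i.1.p = !c) (hr : ∀ j x a, BoxDec j r (x :: a) → WordDec j r a) {j : Bool} {l : List Bool}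
    (h : BoxDec j r l) :
    (∃ a, l = link b r ++ a ∧ WordDec j r a) ∨ (link b r ≠ [] ∧ WordDec false r l) := by
  cases r with
  | nil =>
    obtain ⟨rfl, rfl⟩ := h
    exact Or.inl ⟨[], by simp [link], by simp [WordDec]⟩
  | cons i r =>
    obtain ⟨hb0, hb⟩ := hb i (by simp)
    rcases List.eq_nil_or_concat b with rfl | ⟨b, c, rfl⟩
    · exact absurd rfl hb0
    · have hp := hb c (by simp)
      cases l with
      | nil => exact Or.inr ⟨by simp [link], WordDec.nil _⟩
      | cons x a =>
        have ha := hr _ _ _ h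
        by_cases hx : x = c
        · exact Or.inl ⟨a, by simp [link, hx], ha⟩
        · have : x = i.1.p := by rw [hp]; revert hx; cases x <;> cases c <;> simp
          exact Or.inr ⟨by simp [link], this ▸ ha.toFalse.cons⟩

/-- The head of a flange word either is the first symbol of that word or is absorbed by the
preceding section. -/
lemma absorb_head {s : Sec} {b : BW} (hb : ∀ x ∈ b.head?, x = !s.q) {l p : BW} (hl : l ∈ s.Z)
    (hp : SubBox b p) :
    ∃ l' ∈ s.Z, ∃ b', b'.Sublist b ∧ l ++ p = l' ++ b' ∧
      (b' = b → l' = l ∧ p = b) ∧ (p.length < b.length → b' ≠ b) := by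
  obtain ⟨h1, h2⟩ := hp
  cases p with
  | nil =>
    refine ⟨l, hl, [], by simp, by simp, fun h => ⟨rfl, h⟩, ?_⟩
    rintro h rfl
    simp at h
  | cons x m =>
    cases b with
    | nil => simp at h1
    | cons y b =>
      simp only [List.tail_cons] at h2
      by_cases hx : x = y
      · subst hx
        refine ⟨l, hl, x :: m, by simpa using h2, rfl, fun h => ⟨rfl, h⟩, fun h h' => ?_⟩
        rw [h'] at h
        exact lt_irrefl _ h
      · have hq : x = s.q := by
          have := hb y (by simp)
          revert hx this; cases x <;> cases y <;> cases s.q <;> simp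
        have hne : m ≠ y :: b := by
          rintro rfl
          simpa using h2.length_le
        exact ⟨l ++ [s.q], s.snoc hl, m, h2.trans (by simp), by simp [hq],
          fun h => absurd h hne, fun _ => hne⟩

lemma core_head {s : Sec} {b : BW} {r : List (Sec × BW)} (hb : ∀ x ∈ b.head?, x = !s.q) :
    ∀ x ∈ (core b r).head?, x = !s.q := by
  intro x hx
  apply hb
  rw [← core_append_link b r]
  simp only [Option.mem_def] at hx ⊢
  simp [List.head?_append, hx]

lemma boxDec_analysis {s : Sec} {b : BW} {r : List (Sec × BW)} (hv : Compatible ((s, b) :: r))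
    (hr : ∀ j x a, BoxDec j r (x :: a) → WordDec j r a) {j : Bool} {P P' Q : List Bool} {x : Bool}
    {a : BW} (ha : x :: a = P ++ (P' ++ Q)) (hP : P.tail ∈ s.Z) (hP' : SubBox (core b r) P')
    (hQ : BoxDec j r Q) :
    WordDec true ((s, b) :: r) a ∨
      ∃ l ∈ s.Z, ∃ a', P = x :: l ∧ P' = core b r ∧ Q = link b r ++ a' ∧ WordDec j r a' := by
  obtain ⟨hv1, hv2, hv3⟩ := hv
  have hcl := core_append_link b r
  have hs : (core b r ++ link b r).Sublist b := by rw [hcl]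
  have hlen : (core b r).length + (link b r).length = b.length := by rw [← List.length_append, hcl]
  have hL := link_or hv2 hr hQ
  cases P with
  | nil =>
    left
    cases P' with
    | nil =>
      simp only [List.nil_append] at ha
      subst ha
      refine ⟨[], [], a, j, rfl, s.nil, by simp, hr _ _ _ hQ, fun _ => Or.inl ?_⟩
      rintro rfl
      cases r with
      | nil => simp [BoxDec] at hQ
      | cons i r => exact (hv2 i (by simp)).1 rfl
    | cons y m =>
      simp only [List.nil_append, List.cons_append, List.cons.injEq] at ha
      obtain ⟨rfl, rfl⟩ := ha
      obtain ⟨h1, h2⟩ := hP'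
      simp only [List.tail_cons, List.length_cons] at h1 h2
      have h3 := h2.trans (List.tail_sublist _)
      rcases hL with ⟨a', rfl, ha'⟩ | ⟨hne, hQ'⟩
      · refine ⟨[], m ++ link b r, a', j, by simp, s.nil, ?_, ha', fun _ => Or.inl fun h => ?_⟩
        · exact (h3.append_right _).trans hs
        · have := congrArg List.length h
          simp at this; omega
      · refine ⟨[], m, Q, false, by simp, s.nil, ?_, hQ', fun _ => Or.inl fun h => ?_⟩
        · exact h3.trans ((List.sublist_append_left _ _).trans hs)
        · have := congrArg List.length h
          omega
  | cons y l =>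
    simp only [List.cons_append, List.cons.injEq] at ha
    obtain ⟨rfl, rfl⟩ := ha
    obtain ⟨l', hl', b', hb', heq, hb1, -⟩ := absorb_head (core_head hv1) hP hP'
    simp only [List.tail_cons] at heq hb1
    rcases hL with ⟨a', rfl, ha'⟩ | ⟨hne, hQ'⟩
    · by_cases hbb : b' = core b r
      · right
        obtain ⟨rfl, rfl⟩ := hb1 hbb
        exact ⟨l', hl', a', rfl, rfl, rfl, ha'⟩
      · left
        refine ⟨l', b' ++ link b r, a', j, ?_, hl', ?_, ha', fun _ => Or.inl fun h => hbb ?_⟩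
        · rw [← List.append_assoc, heq]; simp
        · exact (hb'.append_right _).trans hs
        · exact List.append_cancel_right (h.trans hcl.symm)
    · left
      refine ⟨l', b', Q, false, ?_, hl', ?_, hQ', fun _ => Or.inl fun h => ?_⟩
      · rw [← List.append_assoc, heq]; simp
      · exact hb'.trans ((List.sublist_append_left _ _).trans hs)
      · have h1 := congrArg List.length h
        have h2 := hb'.length_le
        have h3 := List.length_pos_iff.2 hne
        omega

lemma BoxDec.wordDec {r : List (Sec × BW)} (hv : Compatible r) {j : Bool} {x : Bool} {a : BW}
    (h : BoxDec j r (x :: a)) : WordDec j r a := by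
  induction r generalizing j x a with
  | nil => simp [BoxDec] at h
  | cons i r ih =>
    obtain ⟨s, b⟩ := i
    obtain ⟨P, P', Q, j', h1, h2, h3, h4, h5⟩ := h
    rcases boxDec_analysis hv (fun j x a h => ih hv.2.2 h) h1 h2 h3 h4 with h | h
    · exact h.weaken
    · obtain ⟨l, hl, a', rfl, rfl, rfl, ha'⟩ := h
      refine ⟨l, b, a', j', ?_, hl, List.Sublist.refl _, ha', fun hj => Or.inr ?_⟩
      · simp only [List.cons_append, List.cons.injEq] at h1
        rw [h1.2, ← List.append_assoc (core b r), core_append_link]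
      · simpa using h5 hj

lemma wordDec_of_length_lt {s : Sec} {b : BW} {r : List (Sec × BW)} {l l' a a' : BW}
    (h : l ++ (b ++ a) = l' ++ (b ++ a')) (hl' : l' ∈ s.Z) (ha : WordDec false r a) (hb : b ≠ [])
    (hlt : l.length < l'.length) : WordDec true ((s, b) :: r) (l ++ (b ++ a)) := by
  obtain ⟨y, rfl⟩ : l <+: l' :=
    List.prefix_of_prefix_length_le (List.prefix_append l (b ++ a))
      (h ▸ List.prefix_append _ _) hlt.le
  have hy : 0 < y.length := by simpa using hlt
  have h' := h
  simp only [List.append_assoc, List.append_cancel_left_eq] at h'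
  have h2 : b ++ a' = b.drop y.length ++ a.drop (y.length - b.length) := by
    rw [← List.drop_append, h', List.drop_left]
  refine ⟨l ++ y, b.drop y.length, a.drop (y.length - b.length), false, ?_, hl',
    List.drop_sublist _ _, ha.sublist (List.drop_sublist _ _), fun _ => Or.inl fun hd => ?_⟩
  · rw [h, h2]
  · have := congrArg List.length hd
    have := List.length_pos_iff.2 hb
    simp at *; omega

lemma wordDec_unique {s : Sec} {b : BW} {r : List (Sec × BW)} (hv : Compatible ((s, b) :: r))
    {l l' a a' : BW} (h : l ++ (b ++ a) = l' ++ (b ++ a')) (hl : l ∈ s.Z) (hl' : l' ∈ s.Z)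
    (ha : WordDec false r a) (ha' : WordDec false r a')
    (hn : ¬ WordDec true ((s, b) :: r) (l ++ (b ++ a))) : l.length = l'.length := by
  by_cases hb : b = []
  · subst hb
    cases r with
    | nil =>
      obtain ⟨rfl, -⟩ := ha
      obtain ⟨rfl, -⟩ := ha'
      simpa using congrArg List.length h
    | cons i r => exact absurd rfl (hv.2.1 i (by simp)).1
  · rcases lt_trichotomy l.length l'.length with h1 | h1 | h1
    · exact absurd (wordDec_of_length_lt h hl' ha hb h1) hn
    · exact h1
    · exact absurd (h ▸ wordDec_of_length_lt h.symm hl ha' hb h1) hn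

lemma delta_ne_zero {b l : List Bool} (h : delta b l ≠ 0) :
    l.length = b.length ∧ l.tail = b.tail := by
  by_contra h'
  exact h (if_neg h')

lemma HeadFree.delta (b : List Bool) : HeadFree (delta b) := fun _ _ _ => rfl

lemma delta_self (b : List Bool) : delta b b = 1 := by simp [delta]

lemma HeadFree.psi (r : List (Sec × BW)) : HeadFree (psi r) := by
  induction r with
  | nil => exact HeadFree.cunit
  | cons i r ih => exact i.1.headFree.conv ((HeadFree.delta _).conv ih)

lemma subBox_of_delta_ne_zero {b l : List Bool} (h : Zigzag.delta b l ≠ 0) : SubBox b l := by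
  obtain ⟨h1, h2⟩ := delta_ne_zero h
  exact ⟨h1.le, h2 ▸ List.Sublist.refl _⟩

lemma boxDec_of_psi_ne_zero {r : List (Sec × BW)} {l : List Bool} (h : Zigzag.psi r l ≠ 0) :
    BoxDec false r l := by
  induction r generalizing l with
  | nil =>
    cases l with
    | nil => exact ⟨rfl, rfl⟩
    | cons x l => exact absurd rfl h
  | cons i r ih =>
    obtain ⟨P, P'', rfl, h1, h2⟩ := exists_of_conv_ne_zero h
    obtain ⟨P', Q, rfl, h3, h4⟩ := exists_of_conv_ne_zero h2
    exact ⟨P, P', Q, false, rfl, i.1.mem _ h1, subBox_of_delta_ne_zero h3, ih h4, by simp⟩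

lemma subBox_of_shufSum_delta_ne_zero {b l m : List Bool}
    (h : shufSum false (Zigzag.delta b) l m ≠ 0) : SubBox b m := by
  obtain ⟨n, hn, h0⟩ : ∃ n ∈ shuf false l m, Zigzag.delta b n ≠ 0 := by
    by_contra! h'
    exact h (List.sum_eq_zero fun x hx => by
      obtain ⟨n, hn, rfl⟩ := List.mem_map.1 hx
      exact h' n hn)
  obtain ⟨h1, h2⟩ := delta_ne_zero h0
  have h3 := length_of_mem_shuf hn
  have h4 := (sublist_of_mem_shuf hn).tail
  simp only [Bool.false_eq_true, if_false] at h4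
  exact ⟨by omega, h2 ▸ h4⟩

lemma shufSum_delta {b l m : List Bool} (h : b.length ≤ m.length) :
    shufSum false (Zigzag.delta b) l m = cunit l * Zigzag.delta b m := by
  cases l with
  | nil => simp [shufSum, shuf_nil_left, cunit]
  | cons x l =>
    simp only [cunit, zero_mul]
    refine List.sum_eq_zero fun y hy => ?_
    obtain ⟨n, hn, rfl⟩ := List.mem_map.1 hy
    have h3 := length_of_mem_shuf hn
    rw [Zigzag.delta, if_neg]
    rintro ⟨h1, -⟩
    simp at h3
    omega

lemma shufSum_delta_mul {b : BW} {g wg : List Bool → ℝ} {l₁ l₂ m₁ m₂ : List Bool}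
    (h0 : SubBox b m₁ → shufSum false g l₂ m₂ = wg l₂ * g m₂)
    (h1 : SubBox b m₁ → m₁.length < b.length → g m₂ = 0) :
    shufSum false (Zigzag.delta b) l₁ m₁ * shufSum false g l₂ m₂
      = (cunit l₁ * Zigzag.delta b m₁) * (wg l₂ * g m₂) := by
  by_cases hs : SubBox b m₁
  · rw [h0 hs]
    rcases lt_or_ge m₁.length b.length with hlt | hge
    · rw [h1 hs hlt]; simp
    · rw [shufSum_delta hge]
  · have e1 : shufSum false (Zigzag.delta b) l₁ m₁ = 0 := by
      by_contra h; exact hs (subBox_of_shufSum_delta_ne_zero h)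
    have e2 : Zigzag.delta b m₁ = 0 := by
      by_contra h; exact hs (subBox_of_delta_ne_zero h)
    rw [e1, e2]; ring

lemma shufSum_psi {r : List (Sec × BW)} {l m : List Bool} (h : ¬ BoxDec true r m) :
    shufSum false (Zigzag.psi r) l m = psiFree r l * Zigzag.psi r m := by
  induction r generalizing l m with
  | nil => exact shufSum_cunit _ _ _
  | cons i r ih =>
    obtain ⟨s, b⟩ := i
    refine (shufSum_conv_eq_mul (wf := s.f) (wg := psiFree r) ((HeadFree.delta _).conv
      (HeadFree.psi r)) fun l₁ l₂ m₁ m₂ _ hm => ?_)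
    rw [s.mul]
    by_cases hz : s.f m₁ = 0
    · simp [hz]
    have hz := s.mem _ hz
    congr 1
    rw [← conv_cunit_left (psiFree r) l₂]
    refine shufSum_conv_eq_mul (HeadFree.psi r) fun l₃ l₄ m₃ m₄ _ hm' =>
      shufSum_delta_mul (fun hs => ih fun hb => h ?_) fun hs hlt => ?_
    · exact ⟨m₁, m₃, m₄, true, by rw [hm, hm'], hz, hs, hb, fun _ => Or.inr rfl⟩
    · by_contra h0
      exact h ⟨m₁, m₃, m₄, false, by rw [hm, hm'], hz, hs, boxDec_of_psi_ne_zero h0,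
        fun _ => Or.inl hlt⟩

/-- The binary word assembled from a list of sections with flange words and chosen words. -/
def wordOf (tr : List ((Sec × BW) × BW)) : BW := (tr.map fun z => z.2 ++ z.1.2).flatten

lemma wordDec_wordOf {tr : List ((Sec × BW) × BW)} (hz : ∀ z ∈ tr, z.2 ∈ z.1.1.Z) :
    WordDec false (tr.map Prod.fst) (wordOf tr) := by
  induction tr with
  | nil => exact ⟨rfl, rfl⟩
  | cons z tr ih =>
    exact ⟨z.2, z.1.2, wordOf tr, false, by simp [wordOf], hz z (by simp), List.Sublist.refl _,
      ih fun z hz' => hz z (by simp [hz']), by simp⟩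

lemma exists_wordOf {r : List (Sec × BW)} {a : BW} (h : WordDec false r a)
    (hn : ¬ WordDec true r a) :
    ∃ tr : List ((Sec × BW) × BW), tr.map Prod.fst = r ∧ (∀ z ∈ tr, z.2 ∈ z.1.1.Z) ∧
      a = wordOf tr := by
  induction r generalizing a with
  | nil => exact ⟨[], rfl, by simp, h.1⟩
  | cons i r ih =>
    obtain ⟨l, b, a', j, rfl, h2, h3, h4, -⟩ := h
    have hb : b = i.2 := by
      by_contra hb
      exact hn ⟨l, b, a', j, rfl, h2, h3, h4, fun _ => Or.inl hb⟩
    subst hb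
    obtain ⟨tr, rfl, htr, rfl⟩ := ih h4.toFalse fun h =>
      hn ⟨l, i.2, a', true, rfl, h2, h3, h, fun _ => Or.inr rfl⟩
    refine ⟨(i, l) :: tr, rfl, ?_, by simp [wordOf]⟩
    rintro z (_ | ⟨_, hz⟩)
    · exact h2
    · exact htr z hz

lemma psi_wordOf {tr : List ((Sec × BW) × BW)} (hne : tr ≠ [])
    (hv : Compatible (tr.map Prod.fst)) (hz : ∀ z ∈ tr, z.2 ∈ z.1.1.Z)
    (hn : ¬ WordDec true (tr.map Prod.fst) (wordOf tr)) (x : Bool) :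
    Zigzag.psi (tr.map Prod.fst) (x :: wordOf tr)
      = (tr.map fun z => z.1.1.f (true :: z.2)).prod := by
  induction tr generalizing x with
  | nil => exact absurd rfl hne
  | cons z tr ih =>
    obtain ⟨⟨s, b⟩, l⟩ := z
    have hw : wordOf (((s, b), l) :: tr) = l ++ (b ++ wordOf tr) := by simp [wordOf]
    have hz' : ∀ z ∈ tr, z.2 ∈ z.1.1.Z := fun z h => hz z (by simp [h])
    have hl : l ∈ s.Z := hz ((s, b), l) (by simp)
    rw [hw] at hn
    set r := tr.map Prod.fst with hr
    have hcl : ∀ a, core b r ++ (link b r ++ a) = b ++ a := fun a => by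
      rw [← List.append_assoc, core_append_link]
    simp only [List.map_cons, ← hr, List.prod_cons, Zigzag.psi] at hv hn ⊢
    rw [hw, ← hcl, ← List.cons_append, conv_eq_single, conv_eq_single]
    · rw [delta_self, one_mul, s.headFree x true]
      congr 1
      cases htr : tr with
      | nil => simp [hr, htr, wordOf, link, Zigzag.psi, cunit]
      | cons i tr' =>
        rw [← htr]
        have hne' : tr ≠ [] := by simp [htr]
        have hb := (hv.2.1 i.1 (by simp [hr, htr])).1
        have hlink : link b r = [b.getLast hb] := by
          simp [hr, htr, link, List.getLast?_eq_some_getLast hb]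
        rw [hlink]
        exact ih hne' hv.2.2 hz' (fun h => hn ⟨l, b, _, true, rfl, hl, List.Sublist.refl _, h,
          fun _ => Or.inr rfl⟩) _
    · intro P' Q _ h _
      exact (delta_ne_zero h).1
    · intro P P'' h hP hP''
      obtain ⟨P', Q, rfl, hP', hQ⟩ := exists_of_conv_ne_zero hP''
      rw [hcl, List.cons_append] at h
      rcases boxDec_analysis hv (fun _ _ _ h => BoxDec.wordDec hv.2.2 h) h (s.mem _ hP)
        (subBox_of_delta_ne_zero hP') (boxDec_of_psi_ne_zero hQ) with h' | h'
      · exact absurd h' hn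
      · obtain ⟨l', hl', a', rfl, rfl, rfl, ha'⟩ := h'
        rw [hcl, List.cons_append, List.cons.injEq] at h
        have := wordDec_unique hv h.2 hl hl' (wordDec_wordOf hz') ha' hn
        simp [this]

/-- Splittings of a binary word along an initial flange word followed by sections and flange
words; if the flag is raised then some flange word is not used completely. -/
def TopDec (j : Bool) (b : BW) (r : List (Sec × BW)) (a : BW) : Prop :=
  ∃ b' a' j', a = b' ++ a' ∧ b'.Sublist b ∧ WordDec j' r a' ∧ (j = true → b' ≠ b ∨ j' = true)

/-- The finite functional attached to an initial flange word followed by sections and flange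
words. -/
noncomputable def topPsi (b : BW) (r : List (Sec × BW)) : List Bool → ℝ :=
  conv (Zigzag.delta (true :: b).dropLast) (Zigzag.psi r)

lemma topDec_analysis {b : BW} {r : List (Sec × BW)} (hne : r ≠ []) (hv : Compatible r)
    (hb : ∀ i ∈ r.head?, ∀ c ∈ b.getLast?, i.1.p = !c) {j x : Bool} {a : BW} {P Q : List Bool}
    (h : x :: a = P ++ Q) (hP : SubBox (true :: b).dropLast P) (hQ : BoxDec j r Q) :
    TopDec true b r a ∨ (P.length = b.length ∧ ∃ a', a = b ++ a' ∧ WordDec j r a') := by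
  obtain ⟨h1, h2⟩ := hP
  cases P with
  | nil =>
    rw [List.nil_append] at h
    subst h
    have ha := hQ.wordDec hv
    by_cases hb0 : b = []
    · exact Or.inr ⟨by simp [hb0], a, by simp [hb0], ha⟩
    · exact Or.inl ⟨[], a, j, rfl, by simp, ha, fun _ => Or.inl (Ne.symm hb0)⟩
  | cons y m =>
    simp only [List.cons_append, List.cons.injEq] at h
    obtain ⟨rfl, rfl⟩ := h
    rcases List.eq_nil_or_concat b with rfl | ⟨b, c, rfl⟩
    · simp at h1
    · rw [List.concat_eq_append, ← List.cons_append, List.dropLast_concat] at h1 h2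
      simp only [List.tail_cons] at h2
      simp only [List.concat_eq_append] at hb ⊢
      rcases link_or (fun i hi => ⟨by simp, hb i hi⟩) (fun _ _ _ h => h.wordDec hv) hQ with
        ⟨a', rfl, ha'⟩ | ⟨-, hQ'⟩
      · have hlink : link (b ++ [c]) r = [c] := by
          cases r with
          | nil => exact absurd rfl hne
          | cons i r => simp [link]
        rw [hlink]
        by_cases hm : m = b
        · exact Or.inr ⟨by simp [hm], a', by simp [hm], ha'⟩
        · exact Or.inl ⟨m ++ [c], a', j, by simp, h2.append_right _, ha',
            fun _ => Or.inl fun h => hm (List.append_cancel_right h)⟩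
      · refine Or.inl ⟨m, Q, false, rfl, h2.trans (by simp), hQ', fun _ => Or.inl fun h => ?_⟩
        have := h2.length_le
        simp [h] at this

lemma shufSum_topPsi {b : BW} {r : List (Sec × BW)} (hne : r ≠ []) (hv : Compatible r)
    (hb : ∀ i ∈ r.head?, ∀ c ∈ b.getLast?, i.1.p = !c) {x : Bool} {a : BW}
    (hn : ¬ TopDec true b r a) (l : List Bool) :
    shufSum false (topPsi b r) l (x :: a) = psiFree r l * topPsi b r (x :: a) := by
  rw [← conv_cunit_left (psiFree r) l]
  refine shufSum_conv_eq_mul (HeadFree.psi r) fun l₁ l₂ m₁ m₂ _ hm =>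
    shufSum_delta_mul (fun hs => shufSum_psi fun h => ?_) fun hs hlt => ?_
  · rcases topDec_analysis hne hv hb hm hs h with h' | ⟨-, a', rfl, h'⟩
    · exact hn h'
    · exact hn ⟨b, a', true, rfl, List.Sublist.refl _, h', fun _ => Or.inr rfl⟩
  · by_contra h0
    rcases topDec_analysis hne hv hb hm hs (boxDec_of_psi_ne_zero h0) with h' | ⟨h', -⟩
    · exact hn h'
    · simp at hlt
      omega

lemma topPsi_wordOf {b : BW} {tr : List ((Sec × BW) × BW)} (hne : tr ≠ [])
    (hv : Compatible (tr.map Prod.fst)) (hz : ∀ z ∈ tr, z.2 ∈ z.1.1.Z)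
    (hn : ¬ TopDec true b (tr.map Prod.fst) (b ++ wordOf tr)) (x : Bool) :
    topPsi b (tr.map Prod.fst) (x :: (b ++ wordOf tr))
      = (tr.map fun z => z.1.1.f (true :: z.2)).prod := by
  have h : x :: (b ++ wordOf tr)
      = (x :: b).dropLast ++ ((x :: b).getLast (by simp) :: wordOf tr) := by
    rw [← List.cons_append]
    conv_lhs => rw [← List.dropLast_append_getLast (List.cons_ne_nil x b)]
    simp
  rw [h, topPsi, conv_eq_single]
  · rw [psi_wordOf hne hv hz]
    · have : Zigzag.delta (true :: b).dropLast (x :: b).dropLast = 1 := by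
        cases b <;> simp [Zigzag.delta]
      rw [this, one_mul]
    · exact fun h => hn ⟨b, _, true, rfl, List.Sublist.refl _, h, fun _ => Or.inr rfl⟩
  · intro P Q _ hP _
    rw [(delta_ne_zero hP).1]
    simp

lemma exists_of_topPsi_ne_zero {b : BW} {r : List (Sec × BW)} (hne : r ≠ []) (hv : Compatible r)
    (hb : ∀ i ∈ r.head?, ∀ c ∈ b.getLast?, i.1.p = !c) {x : Bool} {a : BW}
    (hn : ¬ TopDec true b r a) (h : topPsi b r (x :: a) ≠ 0) :
    ∃ tr : List ((Sec × BW) × BW), tr.map Prod.fst = r ∧ (∀ z ∈ tr, z.2 ∈ z.1.1.Z) ∧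
      a = b ++ wordOf tr := by
  obtain ⟨P, Q, he, hP, hQ⟩ := exists_of_conv_ne_zero h
  rcases topDec_analysis hne hv hb he (subBox_of_delta_ne_zero hP) (boxDec_of_psi_ne_zero hQ)
    with h' | ⟨-, a', rfl, h'⟩
  · exact absurd h' hn
  · obtain ⟨tr, htr, hz, rfl⟩ := exists_wordOf h' fun h =>
      hn ⟨b, a', true, rfl, List.Sublist.refl _, h, fun _ => Or.inr rfl⟩
    exact ⟨tr, htr, hz, rfl⟩

/-! ### Coideals of finite templates -/

lemma clWord_cons (c : Bool × ℕ∞) (cs : List (Bool × ℕ∞)) (N : ℕ) :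
    clWord (c :: cs) N
      = List.replicate (if c.2 = ⊤ then N else c.2.toNat) c.1 ++ clWord cs N := by
  simp [clWord]

lemma clWord_append (cs ds : List (Bool × ℕ∞)) (N : ℕ) :
    clWord (cs ++ ds) N = clWord cs N ++ clWord ds N := by
  simp [clWord]

lemma clWord_mono (cs : List (Bool × ℕ∞)) {N M : ℕ} (h : N ≤ M) :
    (clWord cs N).Sublist (clWord cs M) := by
  induction cs with
  | nil => simp [clWord]
  | cons c cs ih =>
    rw [clWord_cons, clWord_cons]
    refine List.Sublist.append ?_ ih
    split_ifs
    · exact List.replicate_sublist_replicate _ |>.2 h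
    · exact List.Sublist.refl _

lemma Zcl_append {cs ds : List (Bool × ℕ∞)} {a b : BW} (ha : a ∈ Zcl cs) (hb : b ∈ Zcl ds) :
    a ++ b ∈ Zcl (cs ++ ds) := by
  obtain ⟨N, hN⟩ := ha
  obtain ⟨M, hM⟩ := hb
  refine ⟨max N M, ?_⟩
  rw [clWord_append]
  exact (hN.trans (clWord_mono _ (le_max_left _ _))).append
    (hM.trans (clWord_mono _ (le_max_right _ _)))

lemma Zcl_down {cs : List (Bool × ℕ∞)} {a b : BW} (h : a.Sublist b) (hb : b ∈ Zcl cs) :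
    a ∈ Zcl cs := by
  obtain ⟨N, hN⟩ := hb
  exact ⟨N, h.trans hN⟩

lemma nil_mem_Zcl (cs : List (Bool × ℕ∞)) : [] ∈ Zcl cs := ⟨0, by simp⟩

lemma mem_Zcl_top {s : Bool} {m : BW} (hm : ∀ b ∈ m, b = s) : m ∈ Zcl [(s, ⊤)] :=
  ⟨m.length, by simp [clWord, ← List.eq_replicate_iff.2 ⟨rfl, hm⟩]⟩

lemma cons_mem_Zcl {s : Bool} {r : List (Bool × ℕ∞)} {a : BW} (ha : a ∈ Zcl ((s, ⊤) :: r)) :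
    s :: a ∈ Zcl ((s, ⊤) :: r) := by
  obtain ⟨N, hN⟩ := ha
  refine ⟨N + 1, (hN.cons_cons s).trans ?_⟩
  rw [clWord_cons, clWord_cons]
  simpa [List.replicate_succ] using clWord_mono r (Nat.le_succ N)

lemma snoc_mem_Zcl {s : Bool} {r : List (Bool × ℕ∞)} {a : BW} (ha : a ∈ Zcl (r ++ [(s, ⊤)])) :
    a ++ [s] ∈ Zcl (r ++ [(s, ⊤)]) := by
  obtain ⟨N, hN⟩ := ha
  refine ⟨N + 1, (hN.append_right [s]).trans ?_⟩
  rw [clWord_append, clWord_append, List.append_assoc]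
  refine (clWord_mono r (Nat.le_succ N)).append ?_
  simp [clWord, List.replicate_succ']

/-- Lists of clusters of finite templates. -/
inductive FinClusters : List (Bool × ℕ∞) → Prop
  | single (s : Bool) : FinClusters [(s, ⊤)]
  | adjacent (s : Bool) (r : List (Bool × ℕ∞)) :
      FinClusters ((!s, ⊤) :: r) → FinClusters ((s, ⊤) :: (!s, ⊤) :: r)
  | separated (s : Bool) (r : List (Bool × ℕ∞)) :
      FinClusters ((s, ⊤) :: r) → FinClusters ((s, ⊤) :: (!s, 1) :: (s, ⊤) :: r)

lemma finClusters_of_sep (cs : List (Bool × ℕ∞)) (hne : cs ≠ [])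
    (halt : cs.IsChain fun c d => c.1 ≠ d.1)
    (h : ∀ i < cs.length, (cs.getD i (true, 1)).2 ≠ ⊤ → 0 < i ∧ i + 1 < cs.length ∧
      (cs.getD i (true, 1)).2 = 1 ∧ (cs.getD (i - 1) (true, 1)).2 = ⊤ ∧
      (cs.getD (i + 1) (true, 1)).2 = ⊤) : FinClusters cs := by
  induction hn : cs.length using Nat.strong_induction_on generalizing cs with
  | _ n ih =>
    match cs, hne with
    | (s, x) :: rest, _ =>
      have hx : x = ⊤ := by
        by_contra hx
        exact absurd (h 0 (by simp) (by simpa using hx)).1 (lt_irrefl _)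
      subst hx
      match rest, halt, h, hn with
      | [], _, _, _ => exact FinClusters.single s
      | (s', y) :: rest', halt, h, hn =>
        have hs : s' = !s := by
          have := (List.isChain_cons_cons.1 halt).1
          revert this; cases s <;> cases s' <;> simp
        subst hs
        have halt' := (List.isChain_cons_cons.1 halt).2
        by_cases hy : y = ⊤
        · subst hy
          refine FinClusters.adjacent s rest' (ih _ ?_ _ (by simp) halt' ?_ rfl)
          · simp at hn ⊢; omega
          · intro i hi hi'
            have hi0 : 0 < i := by
              rcases Nat.eq_zero_or_pos i with rfl | h0
              · simp at hi'
              · exact h0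
            have := h (i + 1) (by simp at hi ⊢; omega) (by simpa using hi')
            obtain ⟨j, rfl⟩ : ∃ j, i = j + 1 := ⟨i - 1, by omega⟩
            simpa using this
        · obtain ⟨-, h2, h3, -, h5⟩ := h 1 (by simp) (by simpa using hy)
          match rest', halt', h, hn, h2, h5 with
          | [], _, _, _, h2, _ => simp at h2
          | (s'', z) :: r, halt', h, hn, _, h5 =>
            simp only [List.getD_cons_succ, List.getD_cons_zero] at h3 h5
            subst h5
            subst h3
            have hs : s'' = s := by
              have := (List.isChain_cons_cons.1 halt').1
              revert this; cases s <;> cases s'' <;> simp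
            subst hs
            refine FinClusters.separated s'' r (ih _ ?_ _ (by simp)
              (List.isChain_cons_cons.1 halt').2 ?_ rfl)
            · simp at hn ⊢; omega
            · intro i hi hi'
              have hi0 : 0 < i := by
                rcases Nat.eq_zero_or_pos i with rfl | h0
                · simp at hi'
                · exact h0
              have := h (i + 2) (by simp at hi ⊢; omega) (by simpa using hi')
              obtain ⟨j, rfl⟩ : ∃ j, i = j + 1 := ⟨i - 1, by omega⟩
              simpa [Nat.succ_le_iff] using this

lemma Template.IsFiniteTemplate.finClusters {t : Template} (h : t.IsFiniteTemplate) :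
    FinClusters t.clusters :=
  finClusters_of_sep _ t.ne t.alternating h

lemma FinClusters.exists_head {cs : List (Bool × ℕ∞)} (h : FinClusters cs) :
    ∃ p r, cs = (p, ⊤) :: r := by
  cases h <;> exact ⟨_, _, rfl⟩

lemma FinClusters.exists_last {cs : List (Bool × ℕ∞)} (h : FinClusters cs) :
    ∃ q r, cs = r ++ [(q, ⊤)] := by
  induction h with
  | single s => exact ⟨s, [], rfl⟩
  | adjacent s r _ ih =>
    obtain ⟨q, r', hr⟩ := ih
    exact ⟨q, (s, ⊤) :: r', by simp [hr]⟩
  | separated s r _ ih =>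
    obtain ⟨q, r', hr⟩ := ih
    exact ⟨q, (s, ⊤) :: (!s, 1) :: r', by simp [hr]⟩

lemma infSigns_cons_top (s : Bool) (r : List (Bool × ℕ∞)) :
    infSigns ((s, ⊤) :: r) = s :: infSigns r := by simp [infSigns]

lemma infSigns_cons_of_ne {c : Bool × ℕ∞} (hc : c.2 ≠ ⊤) (r : List (Bool × ℕ∞)) :
    infSigns (c :: r) = infSigns r := by simp [infSigns, hc]

lemma interval_ne_zero {s : Bool} {x : ℝ} {l : List Bool} (h : interval s x l ≠ 0) :
    ∀ b ∈ l.tail, b = s := by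
  by_contra h'
  exact h (if_neg h')

lemma evalF_nil_ne_zero {l : List Bool} (h : evalF ([] : List (Bool × ℝ)) l ≠ 0) : l = [] := by
  cases l with
  | nil => rfl
  | cons x l => exact absurd rfl h

lemma FinClusters.tail_mem {cs : List (Bool × ℕ∞)} (h : FinClusters cs) (w : List ℝ)
    {l : List Bool} (hl : evalF ((infSigns cs).zip w) l ≠ 0) : l.tail ∈ Zcl cs := by
  induction h generalizing w l with
  | single s =>
    cases w with
    | nil =>
      rw [List.zip_nil_right] at hl
      rw [evalF_nil_ne_zero hl]
      exact nil_mem_Zcl _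
    | cons x w =>
      obtain ⟨P, Q, rfl, hP, hQ⟩ := exists_of_conv_ne_zero hl
      rw [show Q = [] from evalF_nil_ne_zero hQ, List.append_nil]
      exact mem_Zcl_top (interval_ne_zero hP)
  | adjacent s r _ ih =>
    cases w with
    | nil =>
      rw [List.zip_nil_right] at hl
      rw [evalF_nil_ne_zero hl]
      exact nil_mem_Zcl _
    | cons x w =>
      rw [infSigns_cons_top] at hl
      obtain ⟨P, Q, rfl, hP, hQ⟩ := exists_of_conv_ne_zero hl
      have hP := interval_ne_zero hP
      have hQ' := ih w hQ
      cases P with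
      | nil => exact Zcl_append (nil_mem_Zcl [(s, ⊤)]) hQ'
      | cons y m =>
        simp only [List.tail_cons, List.cons_append] at hP ⊢
        cases Q with
        | nil => exact Zcl_append (mem_Zcl_top hP) (nil_mem_Zcl _)
        | cons z Q =>
          rw [List.tail_cons] at hQ'
          by_cases hz : z = s
          · have := Zcl_append (mem_Zcl_top (m := m ++ [s]) (s := s)
              (by simpa [or_imp, forall_and] using hP)) hQ'
            simpa [hz] using this
          · have hz : z = !s := by revert hz; cases z <;> cases s <;> simp
            subst hz
            exact Zcl_append (mem_Zcl_top hP) (cons_mem_Zcl hQ')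
  | separated s r _ ih =>
    cases w with
    | nil =>
      rw [List.zip_nil_right] at hl
      rw [evalF_nil_ne_zero hl]
      exact nil_mem_Zcl _
    | cons x w =>
      rw [infSigns_cons_top, infSigns_cons_of_ne (by simp)] at hl
      obtain ⟨P, Q, rfl, hP, hQ⟩ := exists_of_conv_ne_zero hl
      have hP := interval_ne_zero hP
      have hQ' := ih w hQ
      cases P with
      | nil => exact Zcl_append (nil_mem_Zcl [(s, ⊤), (!s, 1)]) hQ'
      | cons y m =>
        simp only [List.tail_cons, List.cons_append] at hP ⊢
        cases Q with
        | nil => exact Zcl_append (mem_Zcl_top hP) (nil_mem_Zcl _)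
        | cons z Q =>
          rw [List.tail_cons] at hQ'
          by_cases hz : z = s
          · subst hz
            exact Zcl_append (mem_Zcl_top hP)
              (Zcl_append (nil_mem_Zcl [(!z, 1)]) (cons_mem_Zcl hQ'))
          · have hz : z = !s := by revert hz; cases z <;> cases s <;> simp
            subst hz
            have h1 : [!s] ∈ Zcl [(!s, 1)] := ⟨0, by simp [clWord]⟩
            exact Zcl_append (mem_Zcl_top hP) (Zcl_append h1 hQ')

lemma cons_mem_Zcl_of_exists {s : Bool} {cs : List (Bool × ℕ∞)} (h : ∃ r, cs = (s, ⊤) :: r)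
    {a : BW} (ha : a ∈ Zcl cs) : s :: a ∈ Zcl cs := by
  obtain ⟨r, rfl⟩ := h
  exact cons_mem_Zcl ha

lemma snoc_mem_Zcl_of_exists {s : Bool} {cs : List (Bool × ℕ∞)} (h : ∃ r, cs = r ++ [(s, ⊤)])
    {a : BW} (ha : a ∈ Zcl cs) : a ++ [s] ∈ Zcl cs := by
  obtain ⟨r, rfl⟩ := h
  exact snoc_mem_Zcl ha

/-- The data attached to a section whose clusters form a finite template. -/
noncomputable def secOf (cs : List (Bool × ℕ∞)) (h : FinClusters cs) (w : List ℝ) : Sec where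
  f := evalF ((infSigns cs).zip w)
  Z := Zcl cs
  p := h.exists_head.choose
  q := h.exists_last.choose
  headFree := HeadFree.evalF _
  mul := shufSum_evalF _ _
  mem := fun _ hl => h.tail_mem w hl
  down := Zcl_down
  nil := nil_mem_Zcl _
  cons := fun ha => cons_mem_Zcl_of_exists h.exists_head.choose_spec ha
  snoc := fun ha => snoc_mem_Zcl_of_exists h.exists_last.choose_spec ha

/-! ### The functional `F_λ(u)` on box lists -/

lemma sum_antidiagonalTuple_succ {M : Type*} [AddCommMonoid M] (k n : ℕ)
    (f : (Fin (k + 1) → ℕ) → M) :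
    ∑ c ∈ Finset.Nat.antidiagonalTuple (k + 1) n, f c
      = ∑ i ∈ Finset.range (n + 1), ∑ c ∈ Finset.Nat.antidiagonalTuple k (n - i),
          f (Fin.cons i c) := by
  rw [Finset.sum_sigma']
  refine Finset.sum_bij' (fun c _ => ⟨c 0, Fin.tail c⟩) (fun p _ => Fin.cons p.1 p.2) ?_ ?_ ?_ ?_ ?_
  · intro c hc
    rw [Finset.Nat.mem_antidiagonalTuple, Fin.sum_univ_succ] at hc
    simp only [Finset.mem_sigma, Finset.mem_range, Finset.Nat.mem_antidiagonalTuple, Fin.tail]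
    omega
  · rintro ⟨i, c⟩ hc
    simp only [Finset.mem_sigma, Finset.mem_range, Finset.Nat.mem_antidiagonalTuple] at hc
    simp only [Finset.Nat.mem_antidiagonalTuple, Fin.sum_univ_succ, Fin.cons_zero, Fin.cons_succ]
    omega
  · intro c _
    exact Fin.cons_self_tail c
  · rintro ⟨i, c⟩ _
    simp
  · intro c _
    simp

lemma sum_filter_lt_eq {k : ℕ} (c : Fin k → ℕ) (i : Fin k) :
    ∑ i' ∈ Finset.univ.filter (· < i), c i' = ∑ i', if i' < i then c i' else 0 :=
  Finset.sum_filter _ _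

lemma evalF_eq_sum (u : List (Bool × ℝ)) (l : List Bool) :
    evalF u l = ∑ c ∈ Finset.Nat.antidiagonalTuple u.length l.length,
      ∏ i : Fin u.length, if ((l.drop (∑ i', if i' < i then c i' else 0)).take (c i)).tail
          = List.replicate (c i - 1) (u.get i).1 then (u.get i).2 ^ c i else 0 := by
  induction u generalizing l with
  | nil =>
    cases l with
    | nil => simp [cunit]
    | cons x l => simp [cunit]
  | cons a u ih =>
    rw [evalF_cons, conv_eq_sum]
    simp only [List.length_cons]
    rw [sum_antidiagonalTuple_succ]
    refine Finset.sum_congr rfl fun n hn => ?_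
    have hn : n ≤ l.length := by simpa [Nat.lt_succ_iff] using hn
    rw [ih, List.length_drop, Finset.mul_sum]
    refine Finset.sum_congr rfl fun c _ => ?_
    rw [Fin.prod_univ_succ]
    congr 1
    · have h : ((l.take n).tail = List.replicate (n - 1) a.1) ↔ ∀ b ∈ (l.take n).tail, b = a.1 := by
        rw [List.eq_replicate_iff]
        simp [hn]
      simp [interval, h, hn]
    · simp [Fin.sum_univ_succ, List.drop_drop, Fin.succ_lt_succ_iff]

lemma Fword_eq_evalF (u : List (Bool × ℝ)) (a : BW) (x : Bool) :
    Fword u a = evalF u (x :: a) := by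
  rw [evalF_eq_sum, Fword, Finset.sum_filter]
  refine Finset.sum_congr rfl fun c _ => ?_
  rw [Finset.prod_ite_zero]
  simp only [Finset.mem_univ, true_implies, sum_filter_lt_eq, ← List.drop_one, List.drop_take,
    List.drop_drop]
  simp

lemma conv_nonneg {f g : List Bool → ℝ} (hf : ∀ l, 0 ≤ f l) (hg : ∀ l, 0 ≤ g l) (l : List Bool) :
    0 ≤ conv f g l := by
  rw [conv_eq_sum]
  exact Finset.sum_nonneg fun i _ => mul_nonneg (hf _) (hg _)

lemma cunit_nonneg (l : List Bool) : 0 ≤ (cunit l : ℝ) := by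
  cases l <;> simp [cunit]

lemma evalF_nonneg {u : List (Bool × ℝ)} (hu : ∀ c ∈ u, 0 ≤ c.2) (l : List Bool) :
    0 ≤ evalF u l := by
  induction u generalizing l with
  | nil => exact cunit_nonneg l
  | cons c u ih =>
    refine conv_nonneg (fun p => ?_) (ih fun c hc => hu c (by simp [hc])) l
    rw [interval]
    split_ifs
    · exact pow_nonneg (hu c (by simp)) _
    · exact le_rfl

/-! ### Fundamental quasisymmetric functions -/

section Quasisymmetric

open MvPowerSeries

/-- The variables `x_k, …, x_{k+n-1}` as a sequence of rows. -/
noncomputable def rowVars (k n : ℕ) : List (Bool × MvPowerSeries ℕ ℝ) :=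
  (List.range' k n).map fun v => (true, X v)

/-- The least admissible index of the first box of a list following a box with index `v`. -/
def nextIdx (v : ℕ) : List Bool → ℕ
  | false :: _ => v + 1
  | _ => v

lemma conv_intervalAll_rowVars (k n : ℕ) (l : List Bool) :
    conv (intervalAll true (X k)) (evalF (rowVars (k + 1) n)) l
      = if l.head? = some false then evalF (rowVars (k + 1) n) l
        else evalF (rowVars k (n + 1)) l := by
  have hr : rowVars k (n + 1) = (true, X k) :: rowVars (k + 1) n := by
    simp [rowVars, List.range'_succ]
  rw [hr, evalF_cons]
  cases l with
  | nil => simp [conv, intervalAll]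
  | cons z l =>
    cases z
    · simp [conv, intervalAll, conv_eq_sum]
    · simp only [conv, interval_cons, interval_nil, intervalAll_cons, if_true, one_mul]
      simp [intervalAll]

lemma evalF_rowVars_cons (M k : ℕ) (hk : k ≤ M) (y : Bool) (l : List Bool) :
    evalF (rowVars k (M - k)) (y :: l) = ∑ v ∈ Finset.Ico k M,
      X v * evalF (rowVars (nextIdx v l) (M - nextIdx v l)) l := by
  induction hn : M - k generalizing k with
  | zero =>
    have : k = M := by omega
    simp [this, rowVars, cunit]
  | succ n ih =>
    have hr : rowVars k (n + 1) = (true, X k) :: rowVars (k + 1) n := by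
      simp [rowVars, List.range'_succ]
    have hM : n = M - (k + 1) := by omega
    rw [Finset.sum_eq_sum_Ico_succ_bot (by omega), ← ih (k + 1) (by omega) (by omega), hr,
      evalF_cons]
    simp only [conv, interval_nil, one_mul, interval_cons]
    rw [conv_mul_left, conv_intervalAll_rowVars, add_comm]
    congr 2
    rcases l with _ | ⟨_ | _, l⟩ <;> simp [nextIdx, hn, hM]

/-- Admissibility of the indices of the boxes of a list. -/
def Admissible : ℕ → (l : List Bool) → (Fin l.length → ℕ) → Prop
  | _, [], _ => True
  | k, _ :: l, i => k ≤ i 0 ∧ Admissible (nextIdx (i 0) l) l fun j => i j.succ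

open Classical in
lemma evalF_rowVars_eq_sum (M k : ℕ) (hk : k ≤ M) (l : List Bool) :
    evalF (rowVars k (M - k)) l = ∑ i : Fin l.length → Fin M,
      if Admissible k l (fun j => i j) then ∏ j, (X (i j : ℕ) : MvPowerSeries ℕ ℝ) else 0 := by
  induction l generalizing k with
  | nil =>
    have : evalF (rowVars k (M - k)) [] = 1 := by
      induction rowVars k (M - k) with
      | nil => rfl
      | cons c u ih => simp [conv, ih]
    simp [this, Admissible]
  | cons y l ih =>
    rw [evalF_rowVars_cons M k hk]
    simp only [List.length_cons]
    rw [← (Fin.consEquiv fun _ => Fin M).sum_comp, Fintype.sum_prod_type]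
    have : Finset.Ico k M = (Finset.range M).filter (k ≤ ·) := by
      ext v; simp [and_comm]
    rw [this, Finset.sum_filter, ← Fin.sum_univ_eq_sum_range (fun v => if k ≤ v then
      X v * evalF (rowVars (nextIdx v l) (M - nextIdx v l)) l else 0)]
    refine Finset.sum_congr rfl fun v _ => ?_
    have hv : nextIdx v l ≤ M := by
      rcases l with _ | ⟨_ | _, l⟩ <;> simp [nextIdx, v.2.le]
    rw [ih _ hv]
    by_cases hkv : k ≤ v
    · simp [hkv, Admissible, Fin.prod_univ_succ, Finset.mul_sum, Fin.consEquiv]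
    · simp [hkv, Admissible, Fin.consEquiv]

lemma admissible_cons (k : ℕ) (y : Bool) (a : List Bool) (i : Fin (a.length + 1) → ℕ) :
    Admissible k (y :: a) i ↔ k ≤ i 0 ∧ (∀ j : Fin a.length, i j.castSucc ≤ i j.succ) ∧
      ∀ j : Fin a.length, a.get j = false → i j.castSucc < i j.succ := by
  induction a generalizing k y with
  | nil => simp [Admissible]
  | cons z a ih =>
    rw [Admissible, ih]
    simp only [List.length_cons]
    rw [Fin.forall_fin_succ (P := fun j => i j.castSucc ≤ i j.succ),
      Fin.forall_fin_succ (P := fun j => (z :: a).get j = false → i j.castSucc < i j.succ)]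
    simp only [Fin.castSucc_zero, Fin.castSucc_succ, List.get_cons_zero]
    cases z
    · simp only [nextIdx, List.get_eq_getElem]
      constructor
      · rintro ⟨h1, h2, h3, h4⟩
        exact ⟨h1, ⟨Nat.le_of_succ_le h2, h3⟩, fun _ => h2, h4⟩
      · rintro ⟨h1, ⟨h2, h3⟩, h4, h5⟩
        exact ⟨h1, h4 trivial, h3, h5⟩
    · simp [nextIdx, and_assoc]

lemma lt_of_sum_single_eq {n M : ℕ} {d : ℕ →₀ ℕ} (hd : ∀ v ∈ d.support, v < M)
    {i : Fin n → ℕ} (hi : ∑ j, Finsupp.single (i j) 1 = d) (j : Fin n) : i j < M := by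
  subst hi
  refine hd _ ?_
  rw [Finsupp.mem_support_iff, Finsupp.finsetSum_apply]
  refine (Finset.sum_pos' (fun _ _ => Nat.zero_le _) ⟨j, Finset.mem_univ _, ?_⟩).ne'
  simp

lemma coeff_Fqs (a : BW) (x : Bool) {M : ℕ} {d : ℕ →₀ ℕ} (hd : ∀ v ∈ d.support, v < M) :
    coeff d (Fqs a) = coeff d (evalF (rowVars 0 M) (x :: a)) := by
  classical
  have h := evalF_rowVars_eq_sum M 0 (Nat.zero_le M) (x :: a)
  rw [Nat.sub_zero] at h
  have hX : ∀ n (i : Fin n → ℕ), ∏ j, (X (i j) : MvPowerSeries ℕ ℝ)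
      = monomial (∑ j, Finsupp.single (i j) 1) 1 := by
    intro n i
    simp only [X]
    induction (Finset.univ : Finset (Fin n)) using Finset.induction_on with
    | empty => simp
    | insert j s hj ih => rw [Finset.prod_insert hj, Finset.sum_insert hj, ih,
        monomial_mul_monomial, one_mul]
  rw [h, map_sum]
  simp only [hX, apply_ite (coeff d), map_zero, coeff_monomial, ← ite_and]
  rw [Finset.sum_boole, ← Fintype.card_subtype, ← Nat.card_eq_fintype_card]
  change ((Nat.card _ : ℕ) : ℝ) = _
  congr 1
  refine Nat.card_congr ⟨fun i => ⟨fun j => ⟨i.1 j, lt_of_sum_single_eq hd i.2.2.2 j⟩, ?_⟩,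
    fun i => ⟨fun j => i.1 j, ?_⟩, ?_, ?_⟩
  · exact ⟨(admissible_cons _ _ _ _).2 ⟨Nat.zero_le _, i.2.1, i.2.2.1⟩, i.2.2.2.symm⟩
  · exact ⟨((admissible_cons _ _ _ _).1 i.2.1).2.1, ((admissible_cons _ _ _ _).1 i.2.1).2.2,
      i.2.2.symm⟩
  · intro i; rfl
  · intro i; rfl

/-- The product rule for fundamental quasisymmetric functions. -/
lemma Fqs_mul_Fqs (a b : BW) (x y : Bool) :
    Fqs a * Fqs b = ((shuf false (x :: a) (y :: b)).map fun n => Fqs n.tail).sum := by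
  ext d
  obtain ⟨M, hM⟩ : ∃ M, ∀ v ∈ d.support, v < M :=
    ⟨d.support.sup id + 1, fun v hv => Nat.lt_succ_of_le (Finset.le_sup (f := id) hv)⟩
  have h1 : coeff d (Fqs a * Fqs b)
      = coeff d (evalF (rowVars 0 M) (x :: a) * evalF (rowVars 0 M) (y :: b)) := by
    rw [coeff_mul, coeff_mul]
    refine Finset.sum_congr rfl fun p hp => ?_
    replace hp := Finset.HasAntidiagonal.mem_antidiagonal.1 hp
    rw [coeff_Fqs a x (M := M), coeff_Fqs b y (M := M)]
    · intro v hv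
      refine hM v ?_
      rw [Finsupp.mem_support_iff] at hv ⊢
      rw [← hp, Finsupp.add_apply]
      omega
    · intro v hv
      refine hM v ?_
      rw [Finsupp.mem_support_iff] at hv ⊢
      rw [← hp, Finsupp.add_apply]
      omega
  rw [h1, ← shufSum_evalF _ false, shufSum, map_list_sum, map_list_sum, List.map_map, List.map_map]
  refine congrArg List.sum (List.map_congr_left fun n hn => ?_)
  have hlen := length_of_mem_shuf hn
  cases n with
  | nil => simp at hlen
  | cons z n => exact (coeff_Fqs n z hM).symm

/-- The monomial of the least admissible sequence of indices. -/
noncomputable def leastExp (a : BW) : ℕ →₀ ℕ :=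
  ∑ j : Fin (a.length + 1), Finsupp.single ((a.take j).count false) 1

lemma count_take_succ (a : BW) (j : Fin a.length) :
    (a.take (j + 1)).count false
      = (a.take j).count false + if a.get j = false then 1 else 0 := by
  rw [List.take_add_one, List.getElem?_eq_getElem j.2, List.count_append]
  simp [List.count_singleton]

lemma exists_lt_support (d : ℕ →₀ ℕ) : ∃ M, ∀ v ∈ d.support, v < M :=
  ⟨d.support.sup id + 1, fun _ hv => Nat.lt_succ_of_le (Finset.le_sup (f := id) hv)⟩

lemma coeff_leastExp_self (a : BW) : coeff (leastExp a) (Fqs a) ≠ 0 := by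
  obtain ⟨M, hM⟩ := exists_lt_support (leastExp a)
  change ((Nat.card _ : ℕ) : ℝ) ≠ 0
  rw [Nat.cast_ne_zero, Nat.card_ne_zero]
  constructor
  · refine ⟨⟨fun j => (a.take j).count false, fun j => ?_, fun j hj => ?_, rfl⟩⟩
    · simp only [Fin.val_succ, Fin.val_castSucc]
      rw [count_take_succ]
      exact Nat.le_add_right _ _
    · simp only [Fin.val_succ, Fin.val_castSucc]
      rw [count_take_succ, if_pos hj]
      exact Nat.lt_succ_self _
  · refine Finite.of_injective (β := Fin (a.length + 1) → Fin M)
      (fun i j => ⟨i.1 j, lt_of_sum_single_eq hM i.2.2.2 j⟩) fun i i' h => ?_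
    ext j
    simpa using congrFun h j

lemma toMultiset_sum_single {n : ℕ} (i : Fin n → ℕ) :
    Finsupp.toMultiset (∑ j, Finsupp.single (i j) 1) = (List.ofFn i : Multiset ℕ) := by
  rw [map_sum]
  simp only [Finsupp.toMultiset_single, one_smul]
  induction n with
  | zero => simp
  | succ n ih => rw [Fin.sum_univ_succ, ih, List.ofFn_succ]; rfl

lemma ofFn_eq_of_sum_single_eq {n m : ℕ} {i : Fin n → ℕ} {i' : Fin m → ℕ} (hi : Monotone i)
    (hi' : Monotone i') (h : ∑ j, Finsupp.single (i j) 1 = ∑ j, Finsupp.single (i' j) 1) :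
    List.ofFn i = List.ofFn i' := by
  have hp : (List.ofFn i).Perm (List.ofFn i') := by
    rw [← Multiset.coe_eq_coe, ← toMultiset_sum_single, ← toMultiset_sum_single, h]
  exact hp.eq_of_pairwise' (List.pairwise_ofFn.2 fun _ _ h => hi h.le)
    (List.pairwise_ofFn.2 fun _ _ h => hi' h.le)

lemma count_false_le_of_forall₂ {a b : BW}
    (h : List.Forall₂ (fun x y => x = false → y = false) a b) :
    a.count false ≤ b.count false ∧ (b.count false ≤ a.count false → a = b) := by
  induction h with
  | nil => simp
  | @cons x y a b hxy _ ih =>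
    obtain ⟨h1, h2⟩ := ih
    cases x <;> cases y <;> simp at hxy ⊢
    · exact ⟨h1, h2⟩
    · exact ⟨by omega, by omega⟩
    · exact ⟨h1, h2⟩

lemma eq_of_coeff_leastExp_ne_zero {a b : BW} (h : coeff (leastExp b) (Fqs a) ≠ 0)
    (hc : b.count false ≤ a.count false) : a = b := by
  change ((Nat.card _ : ℕ) : ℝ) ≠ 0 at h
  rw [Nat.cast_ne_zero, Nat.card_ne_zero] at h
  obtain ⟨⟨i, hi1, hi2, hi3⟩⟩ := h.1
  have hb : Monotone fun j : Fin (b.length + 1) => (b.take j).count false :=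
    fun j j' hj => (List.take_sublist_take_left hj).count_le _
  have he := ofFn_eq_of_sum_single_eq (Fin.monotone_iff_le_succ.2 hi1) hb hi3
  have hlen : a.length = b.length := by simpa using congrArg List.length he
  have hval : ∀ (j : ℕ) (hj : j < a.length + 1), i ⟨j, hj⟩ = (b.take j).count false := by
    intro j hj
    have := List.getElem_of_eq he (i := j) (by simpa using hj)
    simpa only [List.getElem_ofFn] using this
  refine (count_false_le_of_forall₂ (List.forall₂_iff_get.2 ⟨hlen, fun j h1 h2 h => ?_⟩)).2 hc
  have h3 := hi2 ⟨j, h1⟩ h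
  have h4 := count_take_succ b ⟨j, h2⟩
  change i ⟨j, _⟩ < i ⟨j + 1, _⟩ at h3
  rw [hval, hval, h4] at h3
  by_contra h5
  rw [if_neg h5] at h3
  exact lt_irrefl _ h3

lemma linearIndependent_Fqs : LinearIndependent ℝ Fqs := by
  rw [linearIndependent_iff]
  intro g hg
  by_contra h0
  obtain ⟨b, hb, hmin⟩ := Finset.exists_min_image g.support (fun a => a.count false)
    (Finsupp.support_nonempty_iff.2 h0)
  have h := congrArg (coeff (leastExp b)) hg
  rw [Finsupp.linearCombination_apply, Finsupp.sum, map_sum, map_zero,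
    Finset.sum_eq_single b] at h
  · rw [map_smul, smul_eq_mul] at h
    exact (mul_ne_zero (Finsupp.mem_support_iff.1 hb) (coeff_leastExp_self b)) h
  · intro a ha hab
    rw [map_smul, smul_eq_mul]
    by_contra h1
    exact hab (eq_of_coeff_leastExp_ne_zero (right_ne_zero_of_mul h1) (hmin a ha))
  · intro hb'
    exact absurd hb hb'

/-- The coefficients of the expansion of `F_λ F_μ` are the structure constants given by
shuffling. -/
lemma eq_sum_single_of_Fqs_mul {a b : BW} {c : BW →₀ ℝ}
    (h : Fqs a * Fqs b = ∑ ν ∈ c.support, c ν • Fqs ν) (x y : Bool) :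
    c = ((shuf false (x :: a) (y :: b)).map fun n => Finsupp.single n.tail 1).sum := by
  apply linearIndependent_Fqs.finsuppLinearCombination_injective
  rw [map_list_sum, List.map_map, Finsupp.linearCombination_apply, Finsupp.sum, ← h,
    Fqs_mul_Fqs a b x y]
  refine congrArg List.sum (List.map_congr_left fun n _ => ?_)
  simp

lemma sublist_of_mem_support {a b : BW} {c : BW →₀ ℝ}
    (h : Fqs a * Fqs b = ∑ ν ∈ c.support, c ν • Fqs ν) {ν : BW} (hν : ν ∈ c.support) :
    b.Sublist ν := by
  obtain ⟨n, hn, h0⟩ : ∃ n ∈ shuf false (true :: a) (true :: b),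
      (Finsupp.single n.tail (1 : ℝ)) ν ≠ 0 := by
    by_contra! h'
    rw [Finsupp.mem_support_iff, eq_sum_single_of_Fqs_mul h true true] at hν
    refine hν ?_
    rw [← Finsupp.applyAddHom_apply, map_list_sum, List.map_map]
    exact List.sum_eq_zero fun x hx => by
      obtain ⟨n, hn, rfl⟩ := List.mem_map.1 hx
      exact h' n hn
  have : n.tail = ν := by
    by_contra h1
    exact h0 (Finsupp.single_eq_of_ne' h1)
  rw [← this]
  simpa using (sublist_of_mem_shuf hn).tail

lemma sum_mul_eq_shufSum {a b : BW} {c : BW →₀ ℝ}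
    (h : Fqs a * Fqs b = ∑ ν ∈ c.support, c ν • Fqs ν) {f : List Bool → ℝ} (hf : HeadFree f)
    (x y : Bool) :
    ∑ ν ∈ c.support, c ν * f (true :: ν) = shufSum false f (x :: a) (y :: b) := by
  have h1 : ∑ ν ∈ c.support, c ν * f (true :: ν)
      = Finsupp.linearCombination ℝ (fun ν => f (true :: ν)) c := by
    simp [Finsupp.linearCombination_apply, Finsupp.sum]
  rw [h1, eq_sum_single_of_Fqs_mul h x y, map_list_sum, List.map_map, shufSum]
  refine congrArg List.sum (List.map_congr_left fun n hn => ?_)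
  have hlen := length_of_mem_shuf hn
  cases n with
  | nil => simp at hlen
  | cons z n => simpa using hf _ _ _

end Quasisymmetric

/-! ### Splittings of templates -/

/-- A section of a template, the weights available from this section on, and the flange clusters
following it. -/
structure Block where
  sec : List (Bool × ℕ∞)
  fin : FinClusters sec
  weights : List ℝ
  flange : List (Bool × ℕ∞)

/-- The clusters of a list of blocks. -/
def catBlocks (L : List Block) : List (Bool × ℕ∞) := (L.map fun b => b.sec ++ b.flange).flatten

lemma catBlocks_cons (b : Block) (L : List Block) :
    catBlocks (b :: L) = b.sec ++ (b.flange ++ catBlocks L) := by simp [catBlocks]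

/-- The abstract section and the flange word attached to a block. -/
noncomputable def Block.item (b : Block) : Sec × BW :=
  (secOf b.sec b.fin b.weights, flangeWord b.flange)

/-- The flange words between sections are nonempty and do not consist of one symbol coming from a
separating cluster. -/
def InnerFlanges : List Block → Prop
  | [] => True
  | b :: L => (L ≠ [] → b.flange ≠ [] ∧ ∀ s, b.flange ≠ [(s, 1)]) ∧ InnerFlanges L

lemma flangeWord_cons (c : Bool × ℕ∞) (A : List (Bool × ℕ∞)) :
    flangeWord (c :: A) = List.replicate c.2.toNat c.1 ++ flangeWord A := by
  simp [flangeWord]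

lemma toNat_ne_zero_of {c : Bool × ℕ∞} (h0 : c.2 ≠ 0) (h1 : c.2 ≠ ⊤) : c.2.toNat ≠ 0 := by
  simp [ENat.toNat_eq_zero, h0, h1]

lemma head?_flangeWord {c : Bool × ℕ∞} {A : List (Bool × ℕ∞)} (h0 : c.2 ≠ 0) (h1 : c.2 ≠ ⊤) :
    (flangeWord (c :: A)).head? = some c.1 := by
  obtain ⟨n, hn⟩ := Nat.exists_eq_succ_of_ne_zero (toNat_ne_zero_of h0 h1)
  simp [flangeWord_cons, hn, List.replicate_succ]

lemma getLast?_flangeWord {c : Bool × ℕ∞} {A : List (Bool × ℕ∞)} (h0 : c.2 ≠ 0) (h1 : c.2 ≠ ⊤) :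
    (flangeWord (A ++ [c])).getLast? = some c.1 := by
  obtain ⟨n, hn⟩ := Nat.exists_eq_succ_of_ne_zero (toNat_ne_zero_of h0 h1)
  simp [flangeWord, hn, List.replicate_succ']

lemma Block.exists_sec_head (b : Block) : ∃ r, b.sec = (b.item.1.p, ⊤) :: r :=
  b.fin.exists_head.choose_spec

lemma Block.exists_sec_last (b : Block) : ∃ r, b.sec = r ++ [(b.item.1.q, ⊤)] :=
  b.fin.exists_last.choose_spec

/-- The sign of a section following a flange word. -/
lemma p_eq_not_getLast {A : List (Bool × ℕ∞)} {L : List Block}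
    (hch : (A ++ catBlocks L).IsChain fun c d => c.1 ≠ d.1)
    (hpos : ∀ c ∈ A, c.2 ≠ 0) (hfin : ∀ c ∈ A, c.2 ≠ ⊤) :
    ∀ i ∈ (L.map Block.item).head?, ∀ c ∈ (flangeWord A).getLast?, i.1.p = !c := by
  intro i hi x hx
  cases L with
  | nil => simp at hi
  | cons b L =>
    obtain rfl : b.item = i := by simpa using hi
    rcases List.eq_nil_or_concat A with rfl | ⟨A, c, rfl⟩
    · simp [flangeWord] at hx
    · rw [List.concat_eq_append] at hch hpos hfin hx
      rw [getLast?_flangeWord (hpos c (by simp)) (hfin c (by simp))] at hx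
      obtain rfl : c.1 = x := by simpa using hx
      obtain ⟨r, hr⟩ := b.exists_sec_head
      rw [catBlocks_cons, hr] at hch
      simp only [List.append_assoc, List.cons_append, List.nil_append] at hch
      have := (List.isChain_append_cons_cons.1 hch).2.1
      revert this
      cases c.1 <;> cases b.item.1.p <;> simp

lemma compatible_items {L : List Block} (hch : (catBlocks L).IsChain fun c d => c.1 ≠ d.1)
    (hpos : ∀ c ∈ catBlocks L, c.2 ≠ 0) (hfin : ∀ b ∈ L, ∀ c ∈ b.flange, c.2 ≠ ⊤)
    (hin : InnerFlanges L) : Compatible (L.map Block.item) := by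
  induction L with
  | nil => trivial
  | cons b L ih =>
    rw [catBlocks_cons] at hch hpos
    have hch' := hch.right_of_append
    have hpos' : ∀ c ∈ b.flange, c.2 ≠ 0 := fun c hc => hpos c (by simp [hc])
    have hfin' := hfin b (by simp)
    refine ⟨?_, ?_, ih hch'.right_of_append (fun c hc => hpos c (by simp [hc]))
      (fun b hb => hfin b (by simp [hb])) hin.2⟩
    · intro x hx
      change x ∈ (flangeWord b.flange).head? at hx
      change x = !b.item.1.q
      obtain ⟨r, hr⟩ := b.exists_sec_last
      cases hA : b.flange with
      | nil => simp [hA, flangeWord] at hx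
      | cons c A =>
        rw [hA] at hx hch hpos' hfin'
        rw [head?_flangeWord (hpos' c (by simp)) (hfin' c (by simp))] at hx
        obtain rfl : c.1 = x := by simpa using hx
        rw [hr] at hch
        simp only [List.append_assoc, List.cons_append, List.nil_append] at hch
        have := (List.isChain_append_cons_cons.1 hch).2.1
        revert this
        cases c.1 <;> cases b.item.1.q <;> simp
    · intro i hi
      refine ⟨?_, p_eq_not_getLast hch' hpos' hfin' i hi⟩
      have hL : L ≠ [] := by rintro rfl; simp at hi
      obtain ⟨c, A, hA⟩ := List.exists_cons_of_ne_nil (hin.1 hL).1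
      change flangeWord b.flange ≠ []
      intro h
      rw [hA] at h hpos' hfin'
      have := head?_flangeWord (A := A) (hpos' c (by simp)) (hfin' c (by simp))
      simp [h] at this

lemma mem_Zcl_of_sublist_flangeWord {A : List (Bool × ℕ∞)} (hfin : ∀ c ∈ A, c.2 ≠ ⊤) {a : BW}
    (h : a.Sublist (flangeWord A)) : a ∈ Zcl A := by
  refine ⟨0, ?_⟩
  convert h using 1
  rw [clWord, flangeWord]
  refine congrArg List.flatten (List.map_congr_left fun c hc => ?_)
  rw [if_neg (hfin c hc)]

lemma exists_decrease_of_sublist {A : List (Bool × ℕ∞)} (hfin : ∀ c ∈ A, c.2 ≠ ⊤) {a : BW}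
    (h : a.Sublist (flangeWord A)) (hne : a ≠ flangeWord A) :
    ∃ pre c post, A = pre ++ c :: post ∧ a ∈ Zcl (pre ++ (c.1, c.2 - 1) :: post) := by
  induction A generalizing a with
  | nil => exact absurd (by simpa [flangeWord] using h) hne
  | cons c A ih =>
    have hfin' : ∀ c ∈ A, c.2 ≠ ⊤ := fun c hc => hfin c (by simp [hc])
    rw [flangeWord_cons] at h hne
    obtain ⟨m, a', rfl, hm, ha'⟩ := List.sublist_append_iff.1 h
    by_cases hm' : m = List.replicate c.2.toNat c.1
    · obtain ⟨pre, c', post, rfl, hmem⟩ := ih hfin' ha' fun h' => hne (by rw [hm', h'])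
      refine ⟨c :: pre, c', post, rfl, Zcl_append (cs := [c]) ?_ hmem⟩
      exact mem_Zcl_of_sublist_flangeWord (by simpa using hfin c) (by simpa [flangeWord] using hm)
    · refine ⟨[], c, A, rfl, Zcl_append (cs := [(c.1, c.2 - 1)]) ?_
        (mem_Zcl_of_sublist_flangeWord hfin' ha')⟩
      obtain ⟨j, hj, rfl⟩ := List.sublist_replicate_iff.1 hm
      obtain ⟨s, x⟩ := c
      lift x to ℕ using hfin (s, x) (by simp)
      refine ⟨0, ?_⟩
      have hj' : j ≠ x := by rintro rfl; simp at hm'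
      have e : ((x : ℕ∞) - 1) = ((x - 1 : ℕ) : ℕ∞) := by simp
      simp only [ENat.toNat_natCast] at hj
      simp only [clWord, e, List.map_cons, List.map_nil, ENat.natCast_ne_top, if_false,
        ENat.toNat_natCast, List.flatten_cons, List.flatten_nil, List.append_nil]
      exact List.replicate_sublist_replicate _ |>.2 (by omega)

/-- The cluster `c` between `pre` and `post` is finite and not separating. -/
def NotSep (pre : List (Bool × ℕ∞)) (c : Bool × ℕ∞) (post : List (Bool × ℕ∞)) : Prop :=
  c.2 ≠ ⊤ ∧ ∀ d ∈ pre.getLast?, d.2 = ⊤ → ∀ e ∈ post.head?, e.2 = ⊤ → c.2 ≠ 1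

lemma mem_Jt_of_notSep {t : Template} {pre post : List (Bool × ℕ∞)} {c : Bool × ℕ∞} {a : BW}
    (ht : t.clusters = pre ++ c :: post) (hc : NotSep pre c post)
    (ha : a ∈ Zcl (pre ++ (c.1, c.2 - 1) :: post)) : a ∈ Jt t := by
  have hget : t.clusters.getD pre.length (true, 1) = c := by simp [ht]
  refine ⟨pre.length, ⟨by simp [ht], by rw [hget]; exact hc.1, ?_⟩, ?_⟩
  · rintro ⟨h1, h2, h3, h4, h5⟩
    rw [hget] at h3
    rcases List.eq_nil_or_concat pre with rfl | ⟨pre, d, rfl⟩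
    · simp at h1
    · cases post with
      | nil => simp [ht] at h2
      | cons e post =>
        refine hc.2 d (by simp) ?_ e (by simp) ?_ h3
        · simpa [ht] using h4
        · have h : pre.length + 1 + 1 - pre.length = 2 := by omega
          simpa [ht, List.getElem?_append_right, h, add_assoc] using h5
  · rw [decAt, hget, ht]
    simpa using ha

lemma mem_Zcl_catBlocks {L : List Block} (hfin : ∀ b ∈ L, ∀ c ∈ b.flange, c.2 ≠ ⊤) {a : BW}
    (h : WordDec false (L.map Block.item) a) : a ∈ Zcl (catBlocks L) := by
  induction L generalizing a with
  | nil =>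
    rw [h.1]
    exact nil_mem_Zcl _
  | cons b L ih =>
    obtain ⟨l, b', a', j, rfl, hl, hb, ha', -⟩ := h
    rw [catBlocks_cons]
    exact Zcl_append hl (Zcl_append (mem_Zcl_of_sublist_flangeWord (hfin b (by simp)) hb)
      (ih (fun b hb => hfin b (by simp [hb])) ha'.toFalse))

lemma exists_notSep_of_wordDec {L : List Block} (hfin : ∀ b ∈ L, ∀ c ∈ b.flange, c.2 ≠ ⊤)
    (hin : InnerFlanges L) {a : BW} (h : WordDec true (L.map Block.item) a) :
    ∃ pre c post, catBlocks L = pre ++ c :: post ∧ pre ≠ [] ∧ NotSep pre c post ∧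
      a ∈ Zcl (pre ++ (c.1, c.2 - 1) :: post) := by
  induction L generalizing a with
  | nil => simp [WordDec] at h
  | cons b L ih =>
    obtain ⟨l, b', a', j, rfl, hl, hb, ha', hj⟩ := h
    have hfin' : ∀ b ∈ L, ∀ c ∈ b.flange, c.2 ≠ ⊤ := fun b hb => hfin b (by simp [hb])
    obtain ⟨r, hr⟩ := b.exists_sec_head
    rw [catBlocks_cons]
    rcases hj rfl with hj | rfl
    · obtain ⟨pre, c, post, hA, hmem⟩ := exists_decrease_of_sublist (hfin b (by simp)) hb hj
      refine ⟨b.sec ++ pre, c, post ++ catBlocks L, by simp [hA], by simp [hr],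
        ⟨hfin b (by simp) c (by simp [hA]), ?_⟩, ?_⟩
      · intro d hd hd' e he he' hc
        rcases List.eq_nil_or_concat pre with rfl | ⟨pre, d', rfl⟩
        · cases post with
          | nil =>
            have hL : L ≠ [] := by rintro rfl; simp [catBlocks] at he
            refine (hin.1 hL).2 c.1 ?_
            rw [hA, ← hc]; rfl
          | cons e' post =>
            obtain rfl : e' = e := by simpa using he
            exact hfin b (by simp) e' (by simp [hA]) he'
        · obtain rfl : d' = d := by simpa [← List.append_assoc] using hd
          exact hfin b (by simp) d' (by simp [hA]) hd'
      · have := Zcl_append hl (Zcl_append hmem (mem_Zcl_catBlocks hfin' ha'.toFalse))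
        simpa using this
    · obtain ⟨pre, c, post, hL, hpre, hns, hmem⟩ := ih hfin' hin.2 ha'
      refine ⟨b.sec ++ (b.flange ++ pre), c, post, by simp [hL], by simp [hr], ?_, ?_⟩
      · refine ⟨hns.1, ?_⟩
        rw [← List.append_assoc, List.getLast?_append_of_ne_nil _ hpre]
        exact hns.2
      · have := Zcl_append hl
          (Zcl_append (mem_Zcl_of_sublist_flangeWord (hfin b (by simp)) hb) hmem)
        simpa using this

lemma mem_Jt_of_topDec {t : Template} {A : List (Bool × ℕ∞)} {L : List Block}
    (ht : t.clusters = A ++ catBlocks L) (hA : ∀ c ∈ A, c.2 ≠ ⊤)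
    (hfin : ∀ b ∈ L, ∀ c ∈ b.flange, c.2 ≠ ⊤) (hin : InnerFlanges L) {a : BW}
    (h : TopDec true (flangeWord A) (L.map Block.item) a) : a ∈ Jt t := by
  obtain ⟨b', a', j, rfl, hb, ha', hj⟩ := h
  rcases hj rfl with hj | rfl
  · obtain ⟨pre, c, post, rfl, hmem⟩ := exists_decrease_of_sublist hA hb hj
    refine mem_Jt_of_notSep (pre := pre) (c := c) (post := post ++ catBlocks L) (by simp [ht])
      ⟨hA c (by simp), ?_⟩ ?_
    · intro d hd hd'
      exact absurd hd' (hA d (by simp [List.mem_of_getLast? hd]))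
    · have := Zcl_append hmem (mem_Zcl_catBlocks hfin ha'.toFalse)
      simpa using this
  · obtain ⟨pre, c, post, hL, hpre, hns, hmem⟩ := exists_notSep_of_wordDec hfin hin ha'
    refine mem_Jt_of_notSep (pre := A ++ pre) (c := c) (post := post) (by simp [ht, hL])
      ⟨hns.1, ?_⟩ ?_
    · rw [List.getLast?_append_of_ne_nil _ hpre]
      exact hns.2
    · have := Zcl_append (mem_Zcl_of_sublist_flangeWord hA hb) hmem
      simpa using this

lemma zip_append_left_eq {α β : Type*} (a b : List α) (w : List β) :
    (a ++ b).zip w = a.zip w ++ b.zip (w.drop a.length) := by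
  induction a generalizing w with
  | nil => simp
  | cons x a ih => cases w <;> simp [ih]

lemma infSigns_append (a b : List (Bool × ℕ∞)) : infSigns (a ++ b) = infSigns a ++ infSigns b := by
  simp [infSigns]

lemma infSigns_eq_nil {A : List (Bool × ℕ∞)} (hA : ∀ c ∈ A, c.2 ≠ ⊤) : infSigns A = [] := by
  simpa [infSigns, List.filter_eq_nil_iff] using hA

/-- The blocks formed by the sections `T`, the flanges `A` and the weights `w`. -/
def blocksOf {k : ℕ} (T : Fin k → List (Bool × ℕ∞)) (h : ∀ i, FinClusters (T i))
    (A : Fin k → List (Bool × ℕ∞)) (w : List ℝ) : List Block :=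
  List.ofFn fun i =>
    ⟨T i, h i, w.drop (∑ i' ∈ Finset.univ.filter (· < i), (infSigns (T i')).length), A i⟩

lemma blocksOf_succ {k : ℕ} (T : Fin (k + 1) → List (Bool × ℕ∞)) (h : ∀ i, FinClusters (T i))
    (A : Fin (k + 1) → List (Bool × ℕ∞)) (w : List ℝ) :
    blocksOf T h A w = ⟨T 0, h 0, w, A 0⟩ :: blocksOf (fun i => T i.succ) (fun i => h i.succ)
      (fun i => A i.succ) (w.drop (infSigns (T 0)).length) := by
  rw [blocksOf, List.ofFn_succ]
  simp [blocksOf, Finset.sum_filter, Fin.sum_univ_succ, Fin.succ_lt_succ_iff, Fin.succ_pos,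
    List.drop_drop]

lemma psiFree_blocksOf {k : ℕ} (T : Fin k → List (Bool × ℕ∞)) (h : ∀ i, FinClusters (T i))
    (A : Fin k → List (Bool × ℕ∞)) (hA : ∀ i, ∀ c ∈ A i, c.2 ≠ ⊤) (w : List ℝ) :
    psiFree ((blocksOf T h A w).map Block.item)
      = evalF ((infSigns (catBlocks (blocksOf T h A w))).zip w) := by
  induction k generalizing w with
  | zero => simp [blocksOf, psiFree, catBlocks, infSigns]
  | succ k ih =>
    rw [blocksOf_succ, catBlocks_cons, infSigns_append, infSigns_append, infSigns_eq_nil (hA 0),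
      List.nil_append, zip_append_left_eq, List.map_cons]
    change conv (evalF ((infSigns (T 0)).zip w)) _ = _
    rw [ih _ _ _ fun i => hA i.succ]
    exact funext fun l => (evalF_append _ _ _).symm

lemma innerFlanges_blocksOf {k : ℕ} (T : Fin k → List (Bool × ℕ∞)) (h : ∀ i, FinClusters (T i))
    (A : Fin k → List (Bool × ℕ∞))
    (hA : ∀ i : Fin k, (i : ℕ) + 1 ≠ k → A i ≠ [] ∧ ∀ s, A i ≠ [(s, 1)]) (w : List ℝ) :
    InnerFlanges (blocksOf T h A w) := by
  induction k generalizing w with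
  | zero => simp [blocksOf, InnerFlanges]
  | succ k ih =>
    rw [blocksOf_succ]
    refine ⟨fun hk => hA 0 ?_, ih _ _ _ (fun i hi => hA i.succ (by simpa using hi)) _⟩
    rintro hk'
    obtain rfl : k = 0 := by simpa using hk'.symm
    simp [blocksOf] at hk

lemma psi_nonneg {r : List (Sec × BW)} (hr : ∀ i ∈ r, ∀ l, 0 ≤ i.1.f l) (l : List Bool) :
    0 ≤ psi r l := by
  induction r generalizing l with
  | nil => exact cunit_nonneg l
  | cons i r ih =>
    obtain ⟨s, b⟩ := i
    refine conv_nonneg (hr (s, b) (by simp)) (conv_nonneg (fun l => ?_)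
      (ih fun i hi => hr i (by simp [hi]))) l
    unfold delta
    split <;> norm_num

lemma topPsi_nonneg {b : BW} {r : List (Sec × BW)} (hr : ∀ i ∈ r, ∀ l, 0 ≤ i.1.f l)
    (l : List Bool) : 0 ≤ topPsi b r l := by
  refine conv_nonneg (fun l => ?_) (psi_nonneg hr) l
  unfold delta
  split <;> norm_num

namespace SectionData

variable {t : Template} (D : SectionData t) (w : List ℝ)

/-- The blocks of a template splitting. -/
noncomputable def blocks : List Block :=
  blocksOf (fun i => (D.T i).clusters) (fun i => (D.secFin i).finClusters) (fun i => D.A i.succ) w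

/-- The sections and flange words of a template splitting, except for the first flange word. -/
noncomputable def items : List (Sec × BW) := (D.blocks w).map Block.item

lemma clusters_eq : t.clusters = D.A 0 ++ catBlocks (D.blocks w) := by
  rw [D.concat, blocks, blocksOf, catBlocks, List.map_ofFn]
  rfl

lemma blocks_flange : ∀ b ∈ D.blocks w, ∀ c ∈ b.flange, c.2 ≠ ⊤ := by
  intro b hb
  obtain ⟨i, rfl⟩ := (List.mem_ofFn' _ _).1 hb
  exact D.finA _

lemma innerFlanges_blocks : InnerFlanges (D.blocks w) := by
  refine innerFlanges_blocksOf _ _ _ (fun i hi => ⟨D.interior_ne _ (by simp) ?_,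
    D.interior_not_sep _ (by simp) ?_⟩) w <;> simpa using hi

lemma items_ne_nil : D.items w ≠ [] := by
  intro h
  obtain ⟨c, hc, hc'⟩ := t.hasInf
  rw [D.clusters_eq w, List.map_eq_nil_iff.1 h] at hc
  exact D.finA 0 c (by simpa [catBlocks] using hc) hc'

lemma isChain_clusters :
    (D.A 0 ++ catBlocks (D.blocks w)).IsChain fun c d => c.1 ≠ d.1 := by
  rw [← D.clusters_eq w]
  exact t.alternating

lemma compatible_items : Compatible (D.items w) := by
  refine Zigzag.compatible_items (D.isChain_clusters w).right_of_append (fun c hc => t.pos c ?_)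
    (D.blocks_flange w) (D.innerFlanges_blocks w)
  rw [D.clusters_eq w]
  simp [hc]

lemma items_head : ∀ i ∈ (D.items w).head?, ∀ c ∈ (flangeWord (D.A 0)).getLast?, i.1.p = !c :=
  p_eq_not_getLast (D.isChain_clusters w)
    (fun c hc => t.pos c (by rw [D.clusters_eq w]; simp [hc])) (D.finA 0)

lemma psiFree_items : psiFree (D.items w) = evalF (paintboxOf t w) := by
  rw [items, blocks, psiFree_blocksOf _ _ _ (fun i => D.finA i.succ), paintboxOf, D.clusters_eq w,
    infSigns_append, infSigns_eq_nil (D.finA 0)]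
  rfl

lemma mem_Jt_of_topDec {a : BW} (h : TopDec true (flangeWord (D.A 0)) (D.items w) a) : a ∈ Jt t :=
  Zigzag.mem_Jt_of_topDec (D.clusters_eq w) (D.finA 0) (D.blocks_flange w)
    (D.innerFlanges_blocks w) h

/-- The sections and flange words of a template splitting together with words in the sections. -/
noncomputable def choices (ℓ : Fin D.k → BW) : List ((Sec × BW) × BW) :=
  List.ofFn fun i => (((secOf (D.T i).clusters (D.secFin i).finClusters
    (w.drop (secOffset D i))), flangeWord (D.A i.succ)), ℓ i)

lemma choices_map_fst (ℓ : Fin D.k → BW) : (D.choices w ℓ).map Prod.fst = D.items w := by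
  rw [choices, items, blocks, blocksOf, List.map_ofFn, List.map_ofFn]
  rfl

lemma exists_choices {tr : List ((Sec × BW) × BW)} (h : tr.map Prod.fst = D.items w) :
    ∃ ℓ, tr = D.choices w ℓ := by
  have hlen : tr.length = D.k := by
    simpa [items, blocks, blocksOf] using congrArg List.length h
  refine ⟨fun i => (tr[(i : ℕ)]'(by omega)).2, List.ext_getElem (by simp [choices, hlen]) ?_⟩
  intro i h1 h2
  have h3 : (tr.map Prod.fst)[i]'(by simpa using h1)
      = ((D.choices w fun _ => []).map Prod.fst)[i]'(by simpa [choices, hlen] using h1) := by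
    simp only [h, choices_map_fst]
  simp only [choices, List.getElem_map, List.getElem_ofFn] at h3 ⊢
  exact Prod.ext h3 rfl

lemma assemble_eq (ℓ : Fin D.k → BW) :
    assemble D ℓ = flangeWord (D.A 0) ++ wordOf (D.choices w ℓ) := by
  rw [assemble, wordOf, choices, List.map_ofFn]
  rfl

lemma mem_choices_iff (ℓ : Fin D.k → BW) :
    (∀ z ∈ D.choices w ℓ, z.2 ∈ z.1.1.Z) ↔ ∀ i, ℓ i ∈ Zt (D.T i) := by
  rw [choices, List.forall_mem_ofFn_iff]
  rfl

variable {D w}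

lemma mem_Zt_of_decompOf {a : BW} {ℓ : Fin D.k → BW} (h : decompOf D a ℓ) : a ∈ Zt t := by
  rw [h.2, D.assemble_eq [], Zt, D.clusters_eq []]
  refine Zcl_append (mem_Zcl_of_sublist_flangeWord (D.finA 0) (List.Sublist.refl _))
    (mem_Zcl_catBlocks (D.blocks_flange []) ?_)
  have := wordDec_wordOf ((D.mem_choices_iff [] ℓ).2 h.1)
  rwa [choices_map_fst] at this

lemma topPsi_eq_prod_Fword {a : BW} {ℓ : Fin D.k → BW} (h : decompOf D a ℓ) (ha : a ∉ Jt t) :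
    topPsi (flangeWord (D.A 0)) (D.items w) (true :: a) = ∏ i, Fword (vD D w i) (ℓ i) := by
  have hn := mt (D.mem_Jt_of_topDec w) ha
  have hc := D.compatible_items w
  have hne := D.items_ne_nil w
  rw [h.2, D.assemble_eq w] at hn ⊢
  rw [← D.choices_map_fst w ℓ] at hn hc hne ⊢
  rw [topPsi_wordOf (by simpa using hne) hc ((D.mem_choices_iff w ℓ).2 h.1) hn, choices, List.map_ofFn,
    List.prod_ofFn]
  exact Finset.prod_congr rfl fun i _ => (Fword_eq_evalF _ _ _).symm

lemma exists_decompOf {a : BW} (ha : a ∉ Jt t)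
    (h : topPsi (flangeWord (D.A 0)) (D.items w) (true :: a) ≠ 0) : ∃ ℓ, decompOf D a ℓ := by
  obtain ⟨tr, htr, hz, rfl⟩ := exists_of_topPsi_ne_zero (D.items_ne_nil w) (D.compatible_items w)
    (D.items_head w) (mt (D.mem_Jt_of_topDec w) ha) h
  obtain ⟨ℓ, rfl⟩ := D.exists_choices w htr
  exact ⟨ℓ, (D.mem_choices_iff w ℓ).1 hz, (D.assemble_eq w ℓ).symm⟩

lemma phiTW_eq_topPsi {a : BW} (ha : a ∉ Jt t) :
    phiTW t D w a
      = ENNReal.ofReal (topPsi (flangeWord (D.A 0)) (D.items w) (true :: a)) := by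
  by_cases h : ∃ ℓ, decompOf D a ℓ
  · have hZ : ¬a ∉ Zt t := not_not.2 (mem_Zt_of_decompOf h.choose_spec)
    rw [phiTW, if_neg hZ, if_neg ha, dif_pos h, topPsi_eq_prod_Fword h.choose_spec ha]
  · have h0 : topPsi (flangeWord (D.A 0)) (D.items w) (true :: a) = 0 := by
      by_contra h0
      exact h (exists_decompOf ha h0)
    rw [phiTW, dif_neg h, if_neg ha, ite_self, h0, ENNReal.ofReal_zero]

lemma topPsi_items_nonneg (hw : ∀ x ∈ w, 0 < x) (b : BW) (l : List Bool) :
    0 ≤ topPsi b (D.items w) l := by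
  refine topPsi_nonneg (fun i hi l => ?_) l
  obtain ⟨b, hb, rfl⟩ := List.mem_map.1 hi
  obtain ⟨j, rfl⟩ := (List.mem_ofFn' _ _).1 hb
  refine evalF_nonneg (fun c hc => ?_) l
  exact (hw _ (List.mem_of_mem_drop (List.of_mem_zip hc).2)).le

end SectionData

lemma mem_Jt_of_sublist {t : Template} {a b : BW} (h : a.Sublist b) (hb : b ∈ Jt t) : a ∈ Jt t :=
  let ⟨p, hp, hb⟩ := hb
  ⟨p, hp, Zcl_down h hb⟩

/-- Proposition 5.1 of the paper, the semifinite analogue of the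
Vershik–Kerov ring theorem for the zigzag graph.  Let `(t, w)` be a semifinite
zigzag growth model.  For every zigzag `λ`, every `μ ∈ Z(t) ∖ J(t)` and every
finitely supported family `(c_ν)` of nonnegative reals with
`F_λ · F_μ = ∑_ν c_ν F_ν` in the algebra of quasisymmetric functions, one has
`∑_ν c_ν φ_{t,w}(ν) = φ_w(λ) · φ_{t,w}(μ)` in `[0, +∞]` (where `φ_{t,w}(ν) = 0` for
`ν ∉ Z(t)` and `φ_w(λ) = F_λ(w)`). -/
theorem phiTW_multiplicativity (t : Template) (hsf : ¬t.IsFiniteTemplate)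
    (D : SectionData t) (w : List ℝ) (hlen : w.length = t.numInf)
    (hwpos : ∀ x ∈ w, 0 < x) (hwsum : w.sum = 1)
    (lam mu : BW) (hmu : mu ∈ Zt t) (hmuJ : mu ∉ Jt t)
    (c : BW →₀ ℝ) (hc : ∀ ν, 0 ≤ c ν)
    (hprod : Fqs lam * Fqs mu = ∑ ν ∈ c.support, c ν • Fqs ν) :
    ∑ ν ∈ c.support, ENNReal.ofReal (c ν) * phiTW t D w ν
      = ENNReal.ofReal (Fword (paintboxOf t w) lam) * phiTW t D w mu := by
  have hnn := SectionData.topPsi_items_nonneg (D := D) hwpos (flangeWord (D.A 0))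
  have hF : 0 ≤ Fword (paintboxOf t w) lam := by
    rw [Fword_eq_evalF _ _ true]
    exact evalF_nonneg (fun c hc => (hwpos _ (List.of_mem_zip hc).2).le) _
  have hsum := sum_mul_eq_shufSum (f := topPsi (flangeWord (D.A 0)) (D.items w)) hprod
    ((HeadFree.delta (true :: flangeWord (D.A 0)).dropLast).conv (HeadFree.psi (D.items w)))
    true true
  have hshuf := shufSum_topPsi (x := true) (D.items_ne_nil w) (D.compatible_items w)
    (D.items_head w) (mt (D.mem_Jt_of_topDec w) hmuJ) (true :: lam)
  rw [D.psiFree_items, ← Fword_eq_evalF] at hshuf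
  rw [SectionData.phiTW_eq_topPsi hmuJ, ← ENNReal.ofReal_mul hF, ← hshuf]
  refine Eq.trans ?_ (congrArg ENNReal.ofReal hsum)
  rw [ENNReal.ofReal_sum_of_nonneg fun ν _ => mul_nonneg (hc ν) (hnn _)]
  refine Finset.sum_congr rfl fun ν hν => ?_
  rw [SectionData.phiTW_eq_topPsi (mt (mem_Jt_of_sublist (sublist_of_mem_support hprod hν)) hmuJ),
    ← ENNReal.ofReal_mul (hc ν)]

end Zigzag
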